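/- For every ε > 0 there exists Y₀ such that the following holds for all Y ≥ Y₀. Set λ = √(log Y · log log Y) and let r be the multiplicative function supported on squarefree integers determined by r(p) = λ/(√p · log p) for primes p with λ ≤ p ≤ exp((log λ)²) and r(p) = 0 for all other primes. Then for every real N with log N > 3λ·log log λ one has (∑_{a,b ≤ Y} ∑_{m,n ≤ N, an = bm} r(a)r(b)) / (∑_{n ≤ Y} r(n)²) ≥ N · exp((2 − ε)·√(log Y / log log Y)). -/

import Mathlib

open scoped Classical

noncomputable section

/-- `λ = √(log Y · log log Y)`. -/
def lam (Y : ℝ) : ℝ := Real.sqrt (Real.log Y * Real.log (Real.log Y))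

section PrimeSums

open Finset Real

theorem sum_log_div_mul_pred_le :
    ∃ C : ℝ, 0 ≤ C ∧ ∀ s : Finset ℕ, (∀ p ∈ s, 2 ≤ p) →
      ∑ p ∈ s, log p / (p * (p - 1)) ≤ C := by
  have hs : Summable fun n : ℕ => 4 * (1 / (n : ℝ) ^ (3 / 2 : ℝ)) :=
    (summable_one_div_nat_rpow.mpr (by norm_num)).mul_left 4
  refine ⟨∑' n : ℕ, 4 * (1 / (n : ℝ) ^ (3 / 2 : ℝ)), tsum_nonneg fun n => by positivity,
    fun s h2 => le_trans (sum_le_sum fun p hp => ?_)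
      (hs.sum_le_tsum s fun n _ => by positivity)⟩
  have hp2 : (2 : ℝ) ≤ p := by exact_mod_cast h2 p hp
  have hp0 : (0 : ℝ) < p := by linarith
  have hlog : log p ≤ 2 * √p := by
    have := log_le_rpow_div hp0.le (ε := 1 / 2) (by norm_num)
    rw [← sqrt_eq_rpow] at this
    linarith
  have hpow : (p : ℝ) ^ (3 / 2 : ℝ) = p * √p := by
    rw [sqrt_eq_rpow, show (3 / 2 : ℝ) = 1 + 1 / 2 by norm_num, rpow_add hp0, rpow_one]
  have hsq : √(p : ℝ) * √p = p := mul_self_sqrt hp0.le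
  have hsp : 0 < √(p : ℝ) := sqrt_pos.mpr hp0
  rw [hpow, mul_one_div, div_le_div_iff₀ (by nlinarith) (by positivity)]
  calc log p * (p * √p) ≤ 2 * √p * (p * √p) := by gcongr
    _ = 2 * p * p := by linear_combination 2 * (p : ℝ) * hsq
    _ ≤ 4 * (p * (p - 1)) := by nlinarith

theorem log_factorial_eq_sum_padicValNat (n : ℕ) :
    log (n.factorial : ℝ) =
      ∑ p ∈ range (n + 1) with p.Prime, (padicValNat p n.factorial : ℝ) * log p := by
  rw [log_nat_eq_sum_factorization, Finsupp.sum]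
  refine (sum_subset ?_ ?_).trans (sum_congr rfl fun p hp => ?_)
  · intro p hp
    have hpp := Nat.prime_of_mem_primeFactors hp
    have := (hpp.dvd_factorial).mp (Nat.dvd_of_mem_primeFactors hp)
    simp [hpp]; omega
  · intro p _ hp
    rw [Finsupp.notMem_support_iff.mp hp]; simp
  · rw [Nat.factorization_def _ (mem_filter.mp hp).2]

/-- Mertens' first theorem. -/
theorem exists_abs_sum_log_div_sub_log_le :
    ∃ C : ℝ, 0 ≤ C ∧ ∀ n : ℕ, 1 ≤ n →
      |(∑ p ∈ range (n + 1) with p.Prime, log p / p) - log n| ≤ C := by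
  obtain ⟨C, hC, hs⟩ := sum_log_div_mul_pred_le
  refine ⟨C + 2, by linarith, fun n hn => ?_⟩
  have hn0 : (0 : ℝ) < n := by exact_mod_cast hn
  have hfac := log_factorial_eq_sum_padicValNat n
  have hup : log (n.factorial : ℝ) ≤ n * log n := by
    rw [← log_pow]
    exact log_le_log (by positivity) (by exact_mod_cast Nat.factorial_le_pow n)
  have hlow : n * log n - n ≤ log (n.factorial : ℝ) := by
    have h1 := Stirling.le_log_factorial_stirling (n := n) (by omega)
    have h2 : 0 ≤ log (n : ℝ) := log_natCast_nonneg n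
    have h3 : 0 ≤ log (2 * π) := log_nonneg (by nlinarith [pi_gt_three])
    linarith
  have htheta : ∑ p ∈ range (n + 1) with p.Prime, log p ≤ log 4 * n := by
    have h := Chebyshev.theta_le_log4_mul_x hn0.le
    rw [Chebyshev.theta, Nat.floor_natCast] at h
    refine le_trans (le_of_eq (sum_congr ?_ fun _ _ => rfl)) h
    ext p
    simp only [mem_filter, mem_range, mem_Ioc]
    constructor
    · rintro ⟨h1, h2⟩; exact ⟨⟨h2.pos, by omega⟩, h2⟩
    · rintro ⟨h1, h2⟩; exact ⟨by omega, h2⟩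
  have hlog4 : log 4 ≤ 2 := by
    rw [show (4 : ℝ) = 2 ^ 2 by norm_num, log_pow]
    have := log_two_lt_d9
    push_cast; linarith
  have key1 : n * (∑ p ∈ range (n + 1) with p.Prime, log p / p) - log 4 * n ≤
      log (n.factorial : ℝ) := by
    rw [hfac]
    refine le_trans (sub_le_sub_left htheta _) ?_
    rw [mul_sum, ← sum_sub_distrib]
    refine sum_le_sum fun p hp => ?_
    obtain ⟨hpn, hpp⟩ := mem_filter.mp hp
    have hpn : p ≤ n := by simpa [Nat.lt_succ_iff] using hpn
    have := Fact.mk hpp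
    have hp0 : (0 : ℝ) < p := by exact_mod_cast hpp.pos
    have hlp : 0 ≤ log (p : ℝ) := log_natCast_nonneg p
    have hv : n / p ≤ padicValNat p n.factorial := by
      rw [padicValNat_factorial (b := Nat.log p n + 1) (by omega)]
      have h1 : 1 ≤ Nat.log p n := Nat.log_pos hpp.one_lt hpn
      have := single_le_sum (f := fun i => n / p ^ i) (s := Ico 1 (Nat.log p n + 1))
        (fun _ _ => Nat.zero_le _) (mem_Ico.mpr ⟨le_refl 1, by omega⟩)
      simpa using this
    have hv' : (n : ℝ) / p - 1 ≤ padicValNat p n.factorial := by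
      have h1 : (n : ℝ) / p < (n / p : ℕ) + 1 := by
        rw [← Nat.floor_div_eq_div (K := ℝ)]
        exact Nat.lt_floor_add_one _
      have h2 : ((n / p : ℕ) : ℝ) ≤ padicValNat p n.factorial := by exact_mod_cast hv
      linarith
    calc n * (log p / p) - log p = ((n : ℝ) / p - 1) * log p := by field_simp
      _ ≤ _ := by gcongr
  have key2 : log (n.factorial : ℝ) ≤
      n * (∑ p ∈ range (n + 1) with p.Prime, log p / p) + n * C := by
    have h := hs {p ∈ range (n + 1) | p.Prime} fun p hp => (mem_filter.mp hp).2.two_le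
    refine le_trans ?_ (add_le_add_right (mul_le_mul_of_nonneg_left h hn0.le) _)
    rw [hfac, mul_sum, mul_sum, ← sum_add_distrib]
    refine sum_le_sum fun p hp => ?_
    obtain ⟨_, hpp⟩ := mem_filter.mp hp
    have := Fact.mk hpp
    have hp2 : (2 : ℝ) ≤ p := by exact_mod_cast hpp.two_le
    have hlp : 0 ≤ log (p : ℝ) := log_natCast_nonneg p
    have hv : ((p : ℝ) - 1) * padicValNat p n.factorial ≤ n := by
      have h1 := sub_one_mul_padicValNat_factorial (p := p) n
      have h2 : (p - 1) * padicValNat p n.factorial ≤ n := by omega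
      have h3 : ((p - 1 : ℕ) : ℝ) = (p : ℝ) - 1 := by
        rw [Nat.cast_sub hpp.one_lt.le]; simp
      rw [← h3]; exact_mod_cast h2
    have hv' : (padicValNat p n.factorial : ℝ) ≤ n / (p - 1) := by
      rw [le_div_iff₀ (by linarith)]; linarith
    have hp1 : (p : ℝ) - 1 ≠ 0 := by linarith
    have hp0 : (p : ℝ) ≠ 0 := by linarith
    calc _ ≤ (n : ℝ) / (p - 1) * log p := by gcongr
      _ = _ := by field_simp; ring
  rw [abs_le]
  constructor
  · have : n * (log n - 1 - C) ≤ n * ∑ p ∈ range (n + 1) with p.Prime, log p / p := by linarith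
    have := le_of_mul_le_mul_left this hn0
    linarith
  · have : n * (∑ p ∈ range (n + 1) with p.Prime, log p / p) ≤ n * (log n + log 4) := by linarith
    have := le_of_mul_le_mul_left this hn0
    linarith

theorem sum_Ioc_one_div_mul_log_bounds {C : ℝ} (hC : ∀ n : ℕ, 1 ≤ n →
      |(∑ p ∈ range (n + 1) with Nat.Prime p, log p / p) - log n| ≤ C) {u v : ℕ} (hu : 2 ≤ u)
    (huv : u ≤ v) :
    ∑ p ∈ Ioc u v with Nat.Prime p, 1 / ((p : ℕ) * log (p : ℕ) : ℝ) ≤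
        1 / log u - 1 / log v + 2 * C / log u ^ 2 ∧
      1 / log (u + 1 : ℕ) - 1 / log (v + 1 : ℕ) - 2 * C / log u ^ 2 ≤
        ∑ p ∈ Ioc u v with Nat.Prime p, 1 / ((p : ℕ) * log (p : ℕ) : ℝ) := by
  set E : ℕ → ℝ := fun n => (∑ p ∈ range (n + 1) with Nat.Prime p, log p / p) - log n with hE
  suffices h : ∑ p ∈ Ioc u v with Nat.Prime p, 1 / ((p : ℕ) * log (p : ℕ) : ℝ) ≤
        1 / log u - 1 / log v + E v / log v ^ 2 + 2 * C / log u ^ 2 - C / log v ^ 2 ∧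
      1 / log (u + 1 : ℕ) - 1 / log (v + 1 : ℕ) + E v / log v ^ 2 - 2 * C / log u ^ 2
        + C / log v ^ 2 ≤ ∑ p ∈ Ioc u v with Nat.Prime p, 1 / ((p : ℕ) * log (p : ℕ) : ℝ) by
    have hEv := abs_le.mp (hC v (by omega))
    have h1 : E v / log v ^ 2 ≤ C / log v ^ 2 := by gcongr; exact hEv.2
    have h2 : -C / log v ^ 2 ≤ E v / log v ^ 2 := by gcongr; exact hEv.1
    rw [neg_div] at h2
    constructor <;> linarith [h.1, h.2]
  induction v, huv using Nat.le_induction with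
  | base =>
    have hEu := abs_le.mp (hC u (by omega))
    have h1 : E u / log u ^ 2 ≤ C / log u ^ 2 := by gcongr; exact hEu.2
    have h2 : -C / log u ^ 2 ≤ E u / log u ^ 2 := by gcongr; exact hEu.1
    rw [neg_div] at h2
    have h3 : 2 * C / log u ^ 2 = C / log u ^ 2 + C / log u ^ 2 := by ring
    simp only [Ioc_self, filter_empty, sum_empty]
    constructor <;> linarith
  | succ v huv ih =>
    have hv2 : (2 : ℝ) ≤ v := by exact_mod_cast hu.trans huv
    have hEv : -C ≤ E v ∧ E v ≤ C := abs_le.mp (hC v (by omega))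
    set x := log (v : ℝ) with hx
    set y := log ((v + 1 : ℕ) : ℝ) with hy
    set w := log ((v + 1 + 1 : ℕ) : ℝ) with hw
    have hx0 : 0 < x := log_pos (by linarith)
    have hxy : x ≤ y := log_le_log (by linarith) (by push_cast; linarith)
    have hyw : y ≤ w := log_le_log (by push_cast; linarith) (by push_cast; linarith)
    have hconc : x + w ≤ 2 * y := by
      rw [hx, hw, hy, ← log_mul (by linarith) (by positivity), two_mul, ← log_mul (by positivity)
        (by positivity)]
      exact log_le_log (by positivity) (by push_cast; nlinarith)
    have hy0 : 0 < y := by linarith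
    have hw0 : 0 < w := by linarith
    set a : ℝ := if (v + 1).Prime then y / ((v + 1 : ℕ) : ℝ) else 0 with ha
    have hstep : ∑ p ∈ Ioc u (v + 1) with Nat.Prime p, 1 / ((p : ℕ) * log (p : ℕ) : ℝ) =
        (∑ p ∈ Ioc u v with Nat.Prime p, 1 / ((p : ℕ) * log (p : ℕ) : ℝ)) + a / y ^ 2 := by
      rw [sum_filter, sum_filter, sum_Ioc_succ_top (by omega)]
      congr 1
      rw [ha]
      split_ifs
      · have : ((v + 1 : ℕ) : ℝ) ≠ 0 := by positivity
        rw [← hy]; field_simp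
      · simp
    have hEstep : E (v + 1) = E v + a - (y - x) := by
      simp only [hE]
      rw [sum_filter, sum_range_succ, ← sum_filter]
      ring
    have hg : 1 / y ^ 2 ≤ 1 / x ^ 2 := by gcongr
    have hup : (y - x) * (1 / y ^ 2) ≤ 1 / x - 1 / y := by
      rw [div_sub_div _ _ hx0.ne' hy0.ne', mul_one_div, div_le_div_iff₀ (by positivity)
        (by positivity)]
      nlinarith [mul_nonneg (sub_nonneg.mpr hxy) (mul_nonneg hy0.le (sub_nonneg.mpr hxy))]
    have hlow : 1 / y - 1 / w ≤ (y - x) * (1 / y ^ 2) := by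
      rw [div_sub_div _ _ hy0.ne' hw0.ne', mul_one_div, div_le_div_iff₀ (by positivity)
        (by positivity)]
      have : (w - y) * y ≤ (y - x) * w := by nlinarith
      nlinarith [mul_le_mul_of_nonneg_left this hy0.le]
    have e1 : E v / x ^ 2 = E v * (1 / x ^ 2) := by ring
    have e2 : C / x ^ 2 = C * (1 / x ^ 2) := by ring
    have e3 : C / y ^ 2 = C * (1 / y ^ 2) := by ring
    have e4 : a / y ^ 2 = a * (1 / y ^ 2) := by ring
    have e5 : (E v + a - (y - x)) / y ^ 2 =
      E v * (1 / y ^ 2) + a * (1 / y ^ 2) - (y - x) * (1 / y ^ 2) := by ring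
    have hEv1 : 0 ≤ E v + C := by linarith [hEv.1]
    rw [hstep, hEstep, e3, e4, e5]
    rw [e1, e2] at ih
    obtain ⟨ih1, ih2⟩ := ih
    have m1 := mul_nonneg (sub_nonneg.mpr hg) (sub_nonneg.mpr hEv.2)
    have m2 := mul_nonneg (sub_nonneg.mpr hg) hEv1
    clear_value E a x y w
    generalize 1 / x ^ 2 = gx at *
    generalize 1 / y ^ 2 = gy at *
    constructor <;> linarith

theorem exists_sum_one_div_mul_log_le {δ : ℝ} (hδ : 0 < δ) :
    ∃ z₀ : ℝ, ∀ z : ℝ, z₀ ≤ z → ∀ v : ℕ,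
      ∑ p ∈ range (v + 1) with Nat.Prime p ∧ z ≤ (p : ℕ),
        1 / ((p : ℕ) * log (p : ℕ) : ℝ) ≤ (1 + δ) / log z := by
  obtain ⟨C, hC0, hC⟩ := exists_abs_sum_log_div_sub_log_le
  have hlim : Filter.Tendsto (fun z : ℝ => log z) Filter.atTop Filter.atTop := tendsto_log_atTop
  obtain ⟨z₀, hz₀⟩ := Filter.eventually_atTop.mp
    (hlim.eventually_ge_atTop ((2 + 8 * C) / δ + 4))
  refine ⟨max z₀ 4, fun z hz v => ?_⟩
  have hz4 : (4 : ℝ) ≤ z := le_trans (le_max_right _ _) hz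
  have hlz := hz₀ z (le_trans (le_max_left _ _) hz)
  set u := ⌈z⌉₊ - 1 with hu
  have hceil : 4 ≤ ⌈z⌉₊ := by
    have := Nat.le_ceil z
    have h2 : (4 : ℝ) ≤ (⌈z⌉₊ : ℝ) := by linarith
    exact_mod_cast h2
  have hu2 : 2 ≤ u := by omega
  have huz : z - 1 ≤ u := by
    rw [hu, Nat.cast_sub (by omega)]
    have := Nat.le_ceil z
    push_cast; linarith
  have hlz0 : 4 ≤ log z := by
    have : 0 ≤ (2 + 8 * C) / δ := by positivity
    linarith
  have hlu : log z - 2 / z ≤ log u := by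
    have hu0 : (0 : ℝ) < u := by linarith
    have h1 : log (z / u) ≤ z / u - 1 := log_le_sub_one_of_pos (by positivity)
    rw [log_div (by linarith) hu0.ne'] at h1
    have h2 : z / u - 1 ≤ 2 / z := by
      rw [div_sub_one hu0.ne', div_le_div_iff₀ hu0 (by linarith)]
      nlinarith
    linarith
  have hzl : log z ≤ z := by linarith [log_le_sub_one_of_pos (show 0 < z by linarith)]
  have hlu' : log z - 2 / log z ≤ log u := by
    have : 2 / z ≤ 2 / log z := by gcongr
    linarith
  have hhalf : log z / 2 ≤ log u := by
    have : 2 / log z ≤ 1 := by rw [div_le_one (by linarith)]; linarith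
    linarith
  rcases lt_or_ge v u with hvu | huv
  · rw [sum_eq_zero_iff_of_nonneg (fun p hp => by have := log_natCast_nonneg p; positivity)|>.mpr]
    · positivity
    · intro p hp
      obtain ⟨h1, h2, h3⟩ := by simpa using hp
      have := Nat.ceil_le.mpr h3
      omega
  have hsub : ∑ p ∈ range (v + 1) with Nat.Prime p ∧ z ≤ (p : ℕ), 1 / ((p : ℕ) * log (p : ℕ) : ℝ) ≤
      ∑ p ∈ Ioc u v with Nat.Prime p, 1 / ((p : ℕ) * log (p : ℕ) : ℝ) := by
    refine sum_le_sum_of_subset_of_nonneg (fun p hp => ?_)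
      fun p _ _ => by have := log_natCast_nonneg p; positivity
    obtain ⟨h1, h2, h3⟩ := by simpa using hp
    have := Nat.ceil_le.mpr h3
    simp only [mem_filter, mem_Ioc]
    exact ⟨⟨by omega, by omega⟩, h2⟩
  have hb := (sum_Ioc_one_div_mul_log_bounds hC hu2 huv).1
  have hlv : 0 ≤ 1 / log (v : ℝ) := by have := log_natCast_nonneg v; positivity
  set x := log z
  set y := log (u : ℝ)
  have hx0 : 0 < x := by linarith
  have hy0 : 0 < y := by linarith
  have h1 : 1 / y ≤ 1 / x + 4 / x ^ 3 := by
    rw [div_add_div _ _ hx0.ne' (by positivity), div_le_div_iff₀ hy0 (by positivity)]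
    have h5 : x ^ 2 - 2 ≤ x * y := by
      have := mul_le_mul_of_nonneg_left hlu' hx0.le
      rwa [mul_sub, mul_div_cancel₀ _ hx0.ne', ← sq] at this
    have h6 : x ^ 4 ≤ (x ^ 2 + 4) * (x * y) := by nlinarith [mul_pos hx0 hy0]
    nlinarith
  have h2 : 2 * C / y ^ 2 ≤ 8 * C / x ^ 2 := by
    have : (x / 2) ^ 2 ≤ y ^ 2 := by gcongr
    calc 2 * C / y ^ 2 ≤ 2 * C / (x / 2) ^ 2 := by gcongr
      _ = 8 * C / x ^ 2 := by field_simp; ring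
  have h3 : 4 / x ^ 3 ≤ 1 / x ^ 2 := by
    rw [div_le_div_iff₀ (by positivity) (by positivity)]
    nlinarith [pow_pos hx0 2]
  have h4 : 1 / x ^ 2 + 8 * C / x ^ 2 ≤ δ / x := by
    rw [← add_div, div_le_div_iff₀ (by positivity) hx0]
    have : (2 + 8 * C) ≤ δ * x := by
      have := mul_le_mul_of_nonneg_left hlz hδ.le
      rw [mul_add, mul_div_cancel₀ _ hδ.ne'] at this
      nlinarith
    nlinarith
  rw [add_div]
  linarith

theorem exists_le_sum_one_div_mul_log {δ : ℝ} (hδ : 0 < δ) :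
    ∃ z₀ : ℝ, ∀ z : ℝ, z₀ ≤ z → ∀ w : ℝ, z ≤ w →
      (1 - δ) / log z - 1 / log w ≤
        ∑ p ∈ range (⌊w⌋₊ + 1) with Nat.Prime p ∧ z ≤ (p : ℕ), 1 / ((p : ℕ) * log (p : ℕ) : ℝ) := by
  obtain ⟨C, hC0, hC⟩ := exists_abs_sum_log_div_sub_log_le
  have hlim : Filter.Tendsto (fun z : ℝ => log z) Filter.atTop Filter.atTop := tendsto_log_atTop
  obtain ⟨z₀, hz₀⟩ := Filter.eventually_atTop.mp
    (hlim.eventually_ge_atTop ((1 + 8 * C) / δ + 4))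
  refine ⟨max z₀ 4, fun z hz w hzw => ?_⟩
  have hz4 : (4 : ℝ) ≤ z := le_trans (le_max_right _ _) hz
  have hlz := hz₀ z (le_trans (le_max_left _ _) hz)
  set u := ⌊z⌋₊ with hu
  have hu4 : 4 ≤ u := Nat.le_floor (by exact_mod_cast hz4)
  have huz : (u : ℝ) ≤ z := Nat.floor_le (by linarith)
  have hzu : z < u + 1 := Nat.lt_floor_add_one z
  have huw : u ≤ ⌊w⌋₊ := Nat.floor_mono hzw
  have hlz0 : 4 ≤ log z := by
    have : 0 ≤ (1 + 8 * C) / δ := by positivity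
    linarith
  have hb := (sum_Ioc_one_div_mul_log_bounds hC (by omega) huw).2
  have hsub : ∑ p ∈ Ioc u ⌊w⌋₊ with Nat.Prime p, 1 / ((p : ℕ) * log (p : ℕ) : ℝ) ≤
      ∑ p ∈ range (⌊w⌋₊ + 1) with Nat.Prime p ∧ z ≤ (p : ℕ), 1 / ((p : ℕ) * log (p : ℕ) : ℝ) := by
    refine sum_le_sum_of_subset_of_nonneg (fun p hp => ?_)
      fun p _ _ => by have := log_natCast_nonneg p; positivity
    simp only [mem_filter, mem_Ioc] at hp
    obtain ⟨⟨h1, h2⟩, h3⟩ := hp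
    have : (u : ℝ) + 1 ≤ p := by exact_mod_cast h1
    simp only [mem_filter, mem_range]
    exact ⟨by omega, h3, by linarith⟩
  have hw : 1 / log ((⌊w⌋₊ + 1 : ℕ) : ℝ) ≤ 1 / log w := by
    have h0 : 0 < log w := log_pos (by linarith)
    have h1 := (Nat.lt_floor_add_one w).le
    have : log w ≤ log ((⌊w⌋₊ + 1 : ℕ) : ℝ) := log_le_log (by linarith) (by push_cast; linarith)
    gcongr
  have hu1 : log ((u + 1 : ℕ) : ℝ) ≤ log z + 1 / log z := by
    have h1 : ((u + 1 : ℕ) : ℝ) ≤ z + 1 := by push_cast; linarith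
    have h2 : log ((z + 1) / z) ≤ (z + 1) / z - 1 := log_le_sub_one_of_pos (by positivity)
    rw [log_div (by linarith) (by linarith)] at h2
    have h3 : (z + 1) / z - 1 = 1 / z := by field_simp; ring
    have hzl : log z ≤ z := by linarith [log_le_sub_one_of_pos (show 0 < z by linarith)]
    have h4 : 1 / z ≤ 1 / log z := by gcongr
    have h5 := log_le_log (by positivity) h1
    linarith
  have hul : log z / 2 ≤ log u := by
    have h1 : z / 2 ≤ u := by linarith
    have h2 : log (z / 2) ≤ log u := log_le_log (by linarith) h1
    rw [log_div (by linarith) (by norm_num)] at h2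
    linarith [log_two_lt_d9]
  set x := log z
  set y := log (u : ℝ)
  set t := log ((u + 1 : ℕ) : ℝ)
  have hx0 : 0 < x := by linarith
  have hy0 : 0 < y := by linarith
  have ht0 : 0 < t := log_pos (by
    have : (4 : ℝ) ≤ u := by exact_mod_cast hu4
    push_cast; linarith)
  have h1 : 1 / x - 1 / x ^ 3 ≤ 1 / t := by
    have : t * (1 / x - 1 / x ^ 3) ≤ 1 := by
      have h0 : 0 ≤ 1 / x - 1 / x ^ 3 := by
        rw [sub_nonneg, div_le_div_iff₀ (by positivity) hx0]
        nlinarith [sq_nonneg x, pow_pos hx0 2]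
      calc t * (1 / x - 1 / x ^ 3) ≤ (x + 1 / x) * (1 / x - 1 / x ^ 3) := by gcongr
        _ = 1 - (1 / x) ^ 4 := by field_simp; ring
        _ ≤ 1 := by have : 0 ≤ (1 / x) ^ 4 := by positivity
                    linarith
    rw [le_div_iff₀ ht0]; linarith
  have h2 : 2 * C / y ^ 2 ≤ 8 * C / x ^ 2 := by
    have : (x / 2) ^ 2 ≤ y ^ 2 := by gcongr
    calc 2 * C / y ^ 2 ≤ 2 * C / (x / 2) ^ 2 := by gcongr
      _ = 8 * C / x ^ 2 := by field_simp; ring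
  have h3 : 1 / x ^ 3 ≤ 1 / x ^ 2 := by
    have : x ^ 2 ≤ x ^ 3 := by nlinarith [pow_pos hx0 2]
    gcongr
  have h4 : 1 / x ^ 2 + 8 * C / x ^ 2 ≤ δ / x := by
    rw [← add_div, div_le_div_iff₀ (by positivity) hx0]
    have : (1 + 8 * C) ≤ δ * x := by
      have := mul_le_mul_of_nonneg_left hlz hδ.le
      rw [mul_add, mul_div_cancel₀ _ hδ.ne'] at this
      nlinarith
    nlinarith
  rw [sub_div]
  linarith

end PrimeSums

section Resonator

open Finset Real

/-- `r` is multiplicative, supported on the squarefree integers, and nonnegative at the primes. -/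
structure IsResonator (r : ℕ → ℝ) : Prop where
  one : r 1 = 1
  mul : ∀ m n : ℕ, Nat.Coprime m n → r (m * n) = r m * r n
  eq_zero : ∀ n : ℕ, ¬ Squarefree n → r n = 0
  prime_nonneg : ∀ p : ℕ, p.Prime → 0 ≤ r p

/-- The sum of `r n ^ 2` over the positive integers `n ≤ Z`. -/
def sqSum (r : ℕ → ℝ) (Z : ℝ) : ℝ := ∑ n ∈ Icc 1 ⌊Z⌋₊, r n ^ 2

variable {r : ℕ → ℝ}

theorem sqSum_nonneg (Z : ℝ) : 0 ≤ sqSum r Z := sum_nonneg fun _ _ => sq_nonneg _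

theorem sqSum_mono : Monotone (sqSum r) := fun _ _ h =>
  sum_le_sum_of_subset_of_nonneg (Icc_subset_Icc_right (Nat.floor_mono h))
    fun _ _ _ => sq_nonneg _

theorem IsResonator.sqSum_pos (hr : IsResonator r) {Z : ℝ} (hZ : 1 ≤ Z) : 0 < sqSum r Z := by
  have h1 : 1 ∈ Icc 1 ⌊Z⌋₊ := mem_Icc.mpr ⟨le_refl 1, Nat.le_floor (by exact_mod_cast hZ)⟩
  have := single_le_sum (f := fun n => r n ^ 2) (fun _ _ => sq_nonneg _) h1
  simp only [hr.one] at this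
  rw [sqSum]; linarith

theorem coprime_prod_of_notMem {s : Finset ℕ} (hs : ∀ p ∈ s, p.Prime) {q : ℕ} (hq : q.Prime)
    (hqs : q ∉ s) : q.Coprime (∏ p ∈ s, p) :=
  Nat.Coprime.prod_right fun p hp => (Nat.coprime_primes hq (hs p hp)).mpr fun h => hqs (h ▸ hp)

theorem IsResonator.map_prod (hr : IsResonator r) {s : Finset ℕ} (hs : ∀ p ∈ s, p.Prime) :
    r (∏ p ∈ s, p) = ∏ p ∈ s, r p := by
  induction s using Finset.induction_on with
  | empty => simpa using hr.one
  | insert q s hq ih =>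
    have hs' : ∀ p ∈ s, p.Prime := fun p hp => hs p (mem_insert_of_mem hp)
    rw [prod_insert hq, prod_insert hq, hr.mul _ _
      (coprime_prod_of_notMem hs' (hs q (mem_insert_self q s)) hq), ih hs']

theorem IsResonator.nonneg (hr : IsResonator r) (n : ℕ) : 0 ≤ r n := by
  by_cases hn : Squarefree n
  · rw [← Nat.prod_primeFactors_of_squarefree hn,
      hr.map_prod fun p hp => Nat.prime_of_mem_primeFactors hp]
    exact prod_nonneg fun p hp => hr.prime_nonneg p (Nat.prime_of_mem_primeFactors hp)
  · rw [hr.eq_zero n hn]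

theorem IsResonator.sum_sq_dvd_le (hr : IsResonator r) {p : ℕ} (hp : p.Prime) {A B : Finset ℕ}
    (h : ∀ m, ¬ p ∣ m → p * m ∈ A → m ∈ B) :
    ∑ n ∈ A with p ∣ n, r n ^ 2 ≤ r p ^ 2 * ∑ m ∈ B, r m ^ 2 := by
  calc ∑ n ∈ A with p ∣ n, r n ^ 2
      ≤ ∑ n ∈ (B.filter fun m => ¬ p ∣ m).image (p * ·), r n ^ 2 := by
        rw [← sum_filter_ne_zero]
        refine sum_le_sum_of_subset_of_nonneg (fun n hn => ?_) fun _ _ _ => sq_nonneg _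
        obtain ⟨hn, hn0⟩ := mem_filter.mp hn
        obtain ⟨hnA, m, rfl⟩ := mem_filter.mp hn
        have hsq : Squarefree (p * m) := by
          by_contra hc
          exact hn0 (by rw [hr.eq_zero _ hc]; simp)
        have hpm : ¬ p ∣ m := by
          rw [← hp.coprime_iff_not_dvd]
          exact Nat.coprime_of_squarefree_mul hsq
        exact mem_image.mpr ⟨m, mem_filter.mpr ⟨h m hpm hnA, hpm⟩, rfl⟩
    _ = ∑ m ∈ B with ¬ p ∣ m, r p ^ 2 * r m ^ 2 := by
        rw [sum_image fun _ _ _ _ h => Nat.eq_of_mul_eq_mul_left hp.pos h]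
        refine sum_congr rfl fun m hm => ?_
        rw [hr.mul _ _ ((hp.coprime_iff_not_dvd).mpr (mem_filter.mp hm).2), mul_pow]
    _ ≤ ∑ m ∈ B, r p ^ 2 * r m ^ 2 :=
        sum_le_sum_of_subset_of_nonneg (filter_subset _ _) fun _ _ _ => by positivity
    _ = _ := by rw [mul_sum]

theorem IsResonator.sqSum_le_prod_mul_sum_coprime (hr : IsResonator r) (Z : ℝ) {s : Finset ℕ}
    (hs : ∀ p ∈ s, p.Prime) :
    sqSum r Z ≤ (∏ p ∈ s, (1 + r p ^ 2)) *
      ∑ n ∈ Icc 1 ⌊Z⌋₊ with ∀ p ∈ s, ¬ p ∣ n, r n ^ 2 := by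
  induction s using Finset.induction_on with
  | empty => simp [sqSum]
  | insert q s hq ih =>
    have hqp := hs q (mem_insert_self q s)
    set A := {n ∈ Icc 1 ⌊Z⌋₊ | ∀ p ∈ s, ¬ p ∣ n} with hA
    set B := {n ∈ Icc 1 ⌊Z⌋₊ | ∀ p ∈ insert q s, ¬ p ∣ n} with hB
    have hsplit : ∑ n ∈ A, r n ^ 2 ≤ (1 + r q ^ 2) * ∑ n ∈ B, r n ^ 2 := by
      have h1 := hr.sum_sq_dvd_le hqp (A := A) (B := B) fun m hqm hm => by
        simp only [hA, hB, mem_filter, mem_Icc, forall_mem_insert] at hm ⊢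
        have hm1 : 1 ≤ m := Nat.pos_of_mul_pos_left hm.1.1
        exact ⟨⟨hm1, le_trans (Nat.le_mul_of_pos_left m hqp.pos) hm.1.2⟩, hqm,
          fun p hp hpm => hm.2 p hp (hpm.mul_left q)⟩
      have h2 : {n ∈ A | ¬ q ∣ n} = B := by
        ext n
        simp only [hA, hB, mem_filter, forall_mem_insert]
        tauto
      rw [← sum_filter_add_sum_filter_not A (fun n => q ∣ n), h2]
      linarith
    refine (ih fun p hp => hs p (mem_insert_of_mem hp)).trans ?_
    rw [prod_insert hq, mul_comm (1 + r q ^ 2), mul_assoc]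
    exact mul_le_mul_of_nonneg_left hsplit (prod_nonneg fun p _ => by positivity)

theorem IsResonator.sum_sq_mul_log_le (hr : IsResonator r) {z Z : ℝ} (hz : 1 ≤ z) (hZ : 0 ≤ Z)
    {Q : Finset ℕ} (hQ : ∀ p : ℕ, p.Prime → z ≤ p → r p ≠ 0 → p ∈ Q)
    (hQp : ∀ p ∈ Q, p.Prime ∧ z ≤ p) :
    ∑ n ∈ Icc 1 ⌊Z⌋₊, r n ^ 2 * log n ≤
      log 4 * z * sqSum r Z + (∑ p ∈ Q, r p ^ 2 * log p) * sqSum r (Z / z) := by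
  have hpoint : ∀ n ∈ Icc 1 ⌊Z⌋₊, r n ^ 2 * log n ≤
      r n ^ 2 * (log 4 * z) + ∑ p ∈ Q, if p ∣ n then r n ^ 2 * log p else 0 := by
    intro n hn
    by_cases h0 : r n = 0
    · simp [h0]
    have hsq : Squarefree n := by
      by_contra hc
      exact h0 (hr.eq_zero n hc)
    have hlog : log n = ∑ p ∈ n.primeFactors, log p := by
      conv_lhs => rw [← Nat.prod_primeFactors_of_squarefree hsq]
      rw [Nat.cast_prod, log_prod fun p hp => by
        exact_mod_cast (Nat.prime_of_mem_primeFactors hp).ne_zero]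
    have hle : log n ≤ log 4 * z + ∑ p ∈ Q, if p ∣ n then log p else 0 := by
      rw [hlog, ← sum_filter_add_sum_filter_not n.primeFactors (fun p : ℕ => (p : ℝ) ≤ z)]
      refine add_le_add ?_ ?_
      · refine le_trans ?_ (Chebyshev.theta_le_log4_mul_x (by linarith))
        refine sum_le_sum_of_subset_of_nonneg (fun p hp => ?_) fun p _ _ => log_natCast_nonneg p
        obtain ⟨h1, h2⟩ := mem_filter.mp hp
        have h3 := Nat.prime_of_mem_primeFactors h1
        exact mem_filter.mpr ⟨mem_Ioc.mpr ⟨h3.pos, Nat.le_floor h2⟩, h3⟩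
      · rw [← sum_filter]
        refine sum_le_sum_of_subset_of_nonneg (fun p hp => ?_) fun p _ _ => log_natCast_nonneg p
        obtain ⟨h1, h2⟩ := mem_filter.mp hp
        have h3 := Nat.prime_of_mem_primeFactors h1
        have h4 := Nat.dvd_of_mem_primeFactors h1
        refine mem_filter.mpr ⟨hQ p h3 (not_le.mp h2).le fun hrp => h0 ?_, h4⟩
        obtain ⟨m, rfl⟩ := h4
        rw [hr.mul _ _ (Nat.coprime_of_squarefree_mul hsq), hrp, zero_mul]
    calc r n ^ 2 * log n ≤ r n ^ 2 * (log 4 * z + ∑ p ∈ Q, if p ∣ n then log p else 0) := by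
          gcongr
      _ = _ := by rw [mul_add, mul_sum]; simp only [mul_ite, mul_zero]
  refine (sum_le_sum hpoint).trans ?_
  rw [sum_add_distrib, ← sum_mul, sum_comm, sqSum, mul_comm (log 4 * z), sum_mul Q]
  gcongr with p hp
  obtain ⟨hpp, hzp⟩ := hQp p hp
  rw [← sum_filter, ← sum_mul, mul_right_comm]
  refine mul_le_mul_of_nonneg_right ?_ (log_natCast_nonneg p)
  refine hr.sum_sq_dvd_le hpp fun m _ hm => ?_
  obtain ⟨h1, h2⟩ := mem_Icc.mp hm
  refine mem_Icc.mpr ⟨Nat.pos_of_mul_pos_left h1, Nat.le_floor ?_⟩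
  rw [le_div_iff₀ (by linarith)]
  have h3 : ((p * m : ℕ) : ℝ) ≤ Z := (Nat.cast_le.mpr h2).trans (Nat.floor_le hZ)
  push_cast at h3
  nlinarith [Nat.cast_nonneg (α := ℝ) m]

theorem sub_sqSum_mul_le_sum_sq_mul_log {Z T : ℝ} (hT : 1 ≤ T) :
    (sqSum r Z - sqSum r T) * log T ≤ ∑ n ∈ Icc 1 ⌊Z⌋₊, r n ^ 2 * log n := by
  have h1 : sqSum r Z - sqSum r T ≤ ∑ n ∈ Icc 1 ⌊Z⌋₊ with T < (n : ℕ), r n ^ 2 := by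
    rw [sub_le_iff_le_add', sqSum,
      ← sum_filter_not_add_sum_filter (Icc 1 ⌊Z⌋₊) (fun n : ℕ => T < (n : ℕ))]
    gcongr
    refine sum_le_sum_of_subset_of_nonneg (fun n hn => ?_) fun _ _ _ => sq_nonneg _
    obtain ⟨h1, h2⟩ := mem_filter.mp hn
    exact mem_Icc.mpr ⟨(mem_Icc.mp h1).1, Nat.le_floor (not_lt.mp h2)⟩
  refine (mul_le_mul_of_nonneg_right h1 (log_nonneg hT)).trans ?_
  rw [sum_mul]
  calc _ ≤ ∑ n ∈ Icc 1 ⌊Z⌋₊ with T < (n : ℕ), r n ^ 2 * log n := by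
        gcongr with n hn
        exact (mem_filter.mp hn).2.le
    _ ≤ _ := sum_le_sum_of_subset_of_nonneg (filter_subset _ _)
        fun n _ _ => mul_nonneg (sq_nonneg _) (log_natCast_nonneg n)

theorem IsResonator.le_sqSum_shift (hr : IsResonator r) {Y x z δ : ℝ} (hz : 1 ≤ z)
    (hδ : 0 < δ) (hδ1 : δ ≤ 1 / 4) (hx : 0 ≤ x) (hY : 1 < Y) (hxY : x ≤ δ * log Y)
    (hzY : log 4 * z ≤ δ * log Y) {Q : Finset ℕ}
    (hQ : ∀ p : ℕ, p.Prime → z ≤ p → r p ≠ 0 → p ∈ Q) (hQp : ∀ p ∈ Q, p.Prime ∧ z ≤ p)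
    (hW : ∑ p ∈ Q, r p ^ 2 * log p ≤ (1 + δ) * log Y) {J : ℕ} (hJ : exp x ≤ z ^ J) :
    δ * (1 - 4 * δ) ^ J * sqSum r Y ≤ sqSum r (Y * exp (-x)) := by
  have hL : 0 < log Y := log_pos hY
  set T := Y * exp (-x) with hTdef
  have hT0 : 0 < T := by positivity
  have hlogT : log T = log Y - x := by
    rw [hTdef, log_mul (by linarith) (exp_pos _).ne', log_exp]; ring
  have hT1 : 1 ≤ T := by
    rw [← log_nonneg_iff hT0, hlogT]; nlinarith
  have hq0 : 0 ≤ 1 - 4 * δ := by linarith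
  have hq1 : 1 - 4 * δ ≤ 1 := by linarith
  have hD0 := sqSum_nonneg (r := r) Y
  have hstep : ∀ Z : ℝ, 0 ≤ Z → sqSum r T ≤ δ * sqSum r Z →
      (1 - 4 * δ) * sqSum r Z ≤ sqSum r (Z / z) := by
    intro Z hZ hTZ
    have h1 := (sub_sqSum_mul_le_sum_sq_mul_log (r := r) (Z := Z) hT1).trans
      (hr.sum_sq_mul_log_le hz hZ hQ hQp)
    have hDZ := sqSum_nonneg (r := r) Z
    have hDz := sqSum_nonneg (r := r) (Z / z)
    have h2 : (1 - δ) * sqSum r Z * ((1 - δ) * log Y) ≤ (sqSum r Z - sqSum r T) * log T := by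
      rw [hlogT]
      refine mul_le_mul (by linarith) (by linarith) (by nlinarith) ?_
      nlinarith
    have h3 : log 4 * z * sqSum r Z ≤ δ * log Y * sqSum r Z := by gcongr
    have h4 : (∑ p ∈ Q, r p ^ 2 * log p) * sqSum r (Z / z) ≤
        (1 + δ) * log Y * sqSum r (Z / z) := by gcongr
    have h5 : log Y * ((1 - 3 * δ) * sqSum r Z) ≤ log Y * ((1 + δ) * sqSum r (Z / z)) := by
      nlinarith [mul_nonneg (sq_nonneg δ) (mul_nonneg hDZ hL.le)]
    have h6 := le_of_mul_le_mul_left h5 hL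
    have h7 : (1 + δ) * ((1 - 4 * δ) * sqSum r Z) ≤ (1 + δ) * sqSum r (Z / z) := by
      nlinarith [mul_nonneg (sq_nonneg δ) hDZ]
    exact le_of_mul_le_mul_left h7 (by linarith)
  have hind : ∀ j : ℕ, δ * (1 - 4 * δ) ^ j * sqSum r Y ≤ sqSum r T ∨
      (1 - 4 * δ) ^ j * sqSum r Y ≤ sqSum r (Y / z ^ j) := by
    intro j
    induction j with
    | zero => right; simp
    | succ j ih =>
      have hdec : (1 - 4 * δ) ^ (j + 1) ≤ (1 - 4 * δ) ^ j :=
        pow_le_pow_of_le_one hq0 hq1 (Nat.le_succ j)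
      have hdec' : δ * (1 - 4 * δ) ^ (j + 1) * sqSum r Y ≤ δ * (1 - 4 * δ) ^ j * sqSum r Y := by
        gcongr
      rcases ih with ih | ih
      · exact Or.inl (hdec'.trans ih)
      · rcases le_total (sqSum r T) (δ * sqSum r (Y / z ^ j)) with h | h
        · right
          have := hstep (Y / z ^ j) (by positivity) h
          rw [div_div, ← pow_succ] at this
          refine le_trans ?_ this
          rw [pow_succ, mul_comm _ (1 - 4 * δ), mul_assoc]
          gcongr
        · left
          refine hdec'.trans (le_trans ?_ h)
          rw [mul_assoc]
          gcongr
  rcases hind J with h | h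
  · exact h
  · have h1 : Y / z ^ J ≤ T := by
      rw [hTdef, exp_neg, ← div_eq_mul_inv]
      gcongr
    refine le_trans ?_ (h.trans (sqSum_mono h1))
    have : 0 ≤ (1 - 4 * δ) ^ J * sqSum r Y := by positivity
    nlinarith

/-- The sum of `r a * r b` over `a, b ≤ Y` and `m, n ≤ N` with `a * n = b * m`. -/
def ratioSum (r : ℕ → ℝ) (Y N : ℝ) : ℝ :=
  ∑ a ∈ Finset.Icc 1 ⌊Y⌋₊, ∑ b ∈ Finset.Icc 1 ⌊Y⌋₊,
    ∑ m ∈ Finset.Icc 1 ⌊N⌋₊, ∑ n ∈ Finset.Icc 1 ⌊N⌋₊, if a * n = b * m then r a * r b else 0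

theorem mul_le_sum_ite {a b g k M : ℕ} (ha : 0 < a) (hb : 0 < b) (hka : a * k ≤ M)
    (hkb : b * k ≤ M) {c : ℝ} (hc : 0 ≤ c) :
    k * c ≤ ∑ m ∈ Icc 1 M, ∑ n ∈ Icc 1 M, if g * a * n = g * b * m then c else 0 := by
  rw [← sum_product']
  have hinj : Set.InjOn (fun i => (a * i, b * i)) (Icc 1 k : Finset ℕ) := fun i _ j _ h =>
    Nat.eq_of_mul_eq_mul_left ha (Prod.ext_iff.mp h).1
  calc (k : ℝ) * c = ∑ x ∈ (Icc 1 k).image fun i => (a * i, b * i),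
        if g * a * x.2 = g * b * x.1 then c else 0 := by
        rw [sum_image hinj, sum_congr rfl fun i _ => if_pos (by ring)]
        simp
    _ ≤ _ := by
        refine sum_le_sum_of_subset_of_nonneg (fun x hx => ?_) fun x _ _ => by
          split_ifs <;> simp [hc]
        obtain ⟨i, hi, rfl⟩ := mem_image.mp hx
        obtain ⟨h1, h2⟩ := mem_Icc.mp hi
        simp only [mem_product, mem_Icc]
        exact ⟨⟨Nat.mul_pos ha h1, (Nat.mul_le_mul_left a h2).trans hka⟩,
          ⟨Nat.mul_pos hb h1, (Nat.mul_le_mul_left b h2).trans hkb⟩⟩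

theorem eq_of_prod_eq_prod {s t : Finset ℕ} (hs : ∀ p ∈ s, p.Prime) (ht : ∀ p ∈ t, p.Prime)
    (h : ∏ p ∈ s, p = ∏ p ∈ t, p) : s = t := by
  rw [← Nat.primeFactors_prod hs, h, Nat.primeFactors_prod ht]

/-- Restricting to `a = g * ∏ s`, `b = g * ∏ t` with `(s, t)` in a family of pairs of disjoint sets
of primes and `g` coprime to all of these. -/
theorem IsResonator.le_ratioSum (hr : IsResonator r) {Y N T : ℝ}
    {G : Finset (Finset ℕ × Finset ℕ)} {k : Finset ℕ × Finset ℕ → ℕ}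
    (hG : ∀ x ∈ G, (∀ p ∈ x.1, p.Prime) ∧ (∀ p ∈ x.2, p.Prime) ∧ Disjoint x.1 x.2)
    (hG1 : ∀ x ∈ G, T * (∏ p ∈ x.1, p : ℕ) ≤ Y ∧ T * (∏ p ∈ x.2, p : ℕ) ≤ Y)
    (hk : ∀ x ∈ G, (k x * (∏ p ∈ x.1, p : ℕ) : ℝ) ≤ N ∧ (k x * (∏ p ∈ x.2, p : ℕ) : ℝ) ≤ N) :
    ∑ x ∈ G, k x * (r (∏ p ∈ x.1, p) * r (∏ p ∈ x.2, p)) *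
        ∑ g ∈ Icc 1 ⌊T⌋₊ with ∀ p ∈ x.1 ∪ x.2, ¬ p ∣ g, r g ^ 2 ≤ ratioSum r Y N := by
  set I : Finset ((Finset ℕ × Finset ℕ) × ℕ) :=
    {y ∈ G ×ˢ Icc 1 ⌊T⌋₊ | ∀ p ∈ y.1.1 ∪ y.1.2, ¬ p ∣ y.2} with hI
  set F : ℕ × ℕ → ℝ := fun z => ∑ m ∈ Icc 1 ⌊N⌋₊, ∑ n ∈ Icc 1 ⌊N⌋₊,
    if z.1 * n = z.2 * m then r z.1 * r z.2 else 0 with hF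
  set φ : (Finset ℕ × Finset ℕ) × ℕ → ℕ × ℕ := fun y =>
    (y.2 * ∏ p ∈ y.1.1, p, y.2 * ∏ p ∈ y.1.2, p) with hφ
  have hF0 : ∀ z, 0 ≤ F z := fun z => sum_nonneg fun m _ => sum_nonneg fun n _ => by
    have := mul_nonneg (hr.nonneg z.1) (hr.nonneg z.2)
    split_ifs <;> simp [this]
  have hpos : ∀ s : Finset ℕ, (∀ p ∈ s, p.Prime) → 0 < ∏ p ∈ s, p := fun s hs =>
    prod_pos fun p hp => (hs p hp).pos
  have hinj : Set.InjOn φ I := by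
    rintro ⟨⟨s, t⟩, g⟩ h ⟨⟨s', t'⟩, g'⟩ h' heq
    simp only [hI, coe_filter, mem_product, mem_Icc, Set.mem_ofPred_eq] at h h'
    obtain ⟨⟨hst, hg, -⟩, -⟩ := h
    obtain ⟨⟨hst', hg', -⟩, -⟩ := h'
    obtain ⟨hs, ht, hd⟩ := hG _ hst
    obtain ⟨hs', ht', hd'⟩ := hG _ hst'
    simp only [hφ, Prod.mk.injEq] at heq hs ht hd hs' ht' hd'
    have hcop : ∀ s t : Finset ℕ, (∀ p ∈ s, p.Prime) → (∀ p ∈ t, p.Prime) → Disjoint s t →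
        (∏ p ∈ s, p).Coprime (∏ p ∈ t, p) := fun s t hs ht hd =>
      Nat.Coprime.prod_left fun p hp =>
        coprime_prod_of_notMem ht (hs p hp) (disjoint_left.mp hd hp)
    have hgg : g = g' := by
      have h1 : Nat.gcd (g * ∏ p ∈ s, p) (g * ∏ p ∈ t, p) = g := by
        rw [Nat.gcd_mul_left, hcop s t hs ht hd, mul_one]
      have h2 : Nat.gcd (g' * ∏ p ∈ s', p) (g' * ∏ p ∈ t', p) = g' := by
        rw [Nat.gcd_mul_left, hcop s' t' hs' ht' hd', mul_one]
      rw [← h1, ← h2, heq.1, heq.2]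
    subst hgg
    rw [eq_of_prod_eq_prod hs hs' (Nat.eq_of_mul_eq_mul_left hg heq.1),
      eq_of_prod_eq_prod ht ht' (Nat.eq_of_mul_eq_mul_left hg heq.2)]
  have hle : ∀ y ∈ I, k y.1 * (r (∏ p ∈ y.1.1, p) * r (∏ p ∈ y.1.2, p)) * r y.2 ^ 2 ≤
      F (φ y) := by
    rintro ⟨⟨s, t⟩, g⟩ h
    simp only [hI, mem_filter, mem_product, mem_Icc] at h
    obtain ⟨⟨hst, hg, -⟩, hcop⟩ := h
    obtain ⟨hs, ht, hd⟩ := hG _ hst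
    have hkx := hk _ hst
    simp only at hs ht hkx hcop ⊢
    have hgs : g.Coprime (∏ p ∈ s, p) := Nat.Coprime.prod_right fun p hp =>
      ((hs p hp).coprime_iff_not_dvd.mpr (hcop p (mem_union_left _ hp))).symm
    have hgt : g.Coprime (∏ p ∈ t, p) := Nat.Coprime.prod_right fun p hp =>
      ((ht p hp).coprime_iff_not_dvd.mpr (hcop p (mem_union_right _ hp))).symm
    have h1 := mul_le_sum_ite (g := g) (k := k (s, t)) (M := ⌊N⌋₊) (hpos s hs) (hpos t ht)
      (Nat.le_floor (by push_cast at hkx ⊢; linarith [hkx.1]))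
      (Nat.le_floor (by push_cast at hkx ⊢; linarith [hkx.2]))
      (mul_nonneg (hr.nonneg (g * ∏ p ∈ s, p)) (hr.nonneg (g * ∏ p ∈ t, p)))
    refine le_trans (le_of_eq ?_) h1
    rw [hr.mul _ _ hgs, hr.mul _ _ hgt]
    ring
  calc _ = ∑ y ∈ I, k y.1 * (r (∏ p ∈ y.1.1, p) * r (∏ p ∈ y.1.2, p)) * r y.2 ^ 2 := by
        rw [hI, sum_filter, sum_product]
        simp_rw [sum_filter, mul_sum, mul_ite, mul_zero]
    _ ≤ ∑ y ∈ I, F (φ y) := sum_le_sum hle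
    _ = ∑ z ∈ I.image φ, F z := (sum_image hinj).symm
    _ ≤ ∑ z ∈ Icc 1 ⌊Y⌋₊ ×ˢ Icc 1 ⌊Y⌋₊, F z := by
        refine sum_le_sum_of_subset_of_nonneg (fun z hz => ?_) fun z _ _ => hF0 z
        obtain ⟨⟨⟨s, t⟩, g⟩, hy, rfl⟩ := mem_image.mp hz
        simp only [hI, mem_filter, mem_product, mem_Icc] at hy
        obtain ⟨⟨hst, hg, hgT⟩, -⟩ := hy
        obtain ⟨hs, ht, -⟩ := hG _ hst
        have hY' := hG1 _ hst
        have hgT' : (g : ℝ) ≤ T := (Nat.le_floor_iff' (by omega)).mp hgT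
        simp only [hφ, mem_product, mem_Icc]
        refine ⟨⟨Nat.mul_pos hg (hpos s hs), Nat.le_floor ?_⟩,
          ⟨Nat.mul_pos hg (hpos t ht), Nat.le_floor ?_⟩⟩
        · rw [Nat.cast_mul]
          exact (mul_le_mul_of_nonneg_right hgT' (Nat.cast_nonneg _)).trans hY'.1
        · rw [Nat.cast_mul]
          exact (mul_le_mul_of_nonneg_right hgT' (Nat.cast_nonneg _)).trans hY'.2
    _ = _ := by rw [sum_product]; rfl

end Resonator

section DisjointPairs

open Finset Real

/-- The pairs of disjoint subsets of `P`. -/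
def disjointPairs (P : Finset ℕ) : Finset (Finset ℕ × Finset ℕ) :=
  {z ∈ P.powerset ×ˢ P.powerset | Disjoint z.1 z.2}

theorem mem_disjointPairs {P : Finset ℕ} {z : Finset ℕ × Finset ℕ} :
    z ∈ disjointPairs P ↔ (z.1 ⊆ P ∧ z.2 ⊆ P) ∧ Disjoint z.1 z.2 := by
  simp [disjointPairs]

theorem sum_disjointPairs (P : Finset ℕ) (x y : ℕ → ℝ) :
    ∑ z ∈ disjointPairs P, (∏ p ∈ z.1, x p) * ∏ p ∈ z.2, y p = ∏ p ∈ P, (1 + x p + y p) := by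
  have h1 : ∏ p ∈ P, (1 + x p + y p) = ∏ p ∈ P, (x p + (1 + y p)) :=
    prod_congr rfl fun p _ => by ring
  rw [h1, prod_add, disjointPairs, sum_filter, sum_product]
  refine sum_congr rfl fun s _ => ?_
  rw [prod_one_add, mul_sum, ← sum_filter]
  refine sum_congr (ext fun t => ?_) fun _ _ => rfl
  simp only [mem_filter, mem_powerset, subset_sdiff, disjoint_comm]

theorem sum_le_prod_mul_exp {P : Finset ℕ} {f g h : ℕ → ℝ} {a M : ℝ}
    {B : Finset (Finset ℕ × Finset ℕ)} (hB : B ⊆ disjointPairs P) (hf : ∀ p ∈ P, 0 ≤ f p)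
    (hgh : ∀ p ∈ P, 2 ≤ exp (g p) + exp (h p))
    (ha : ∀ z ∈ B, a ≤ ∑ p ∈ z.1, g p + ∑ p ∈ z.2, h p)
    (hM : ∑ p ∈ P, f p * (exp (g p) + exp (h p) - 2) ≤ M) :
    ∑ z ∈ B, (∏ p ∈ z.1, f p) * ∏ p ∈ z.2, f p ≤ (∏ p ∈ P, (1 + 2 * f p)) * exp (M - a) := by
  have hnn : ∀ z ∈ disjointPairs P, 0 ≤ (∏ p ∈ z.1, f p) * ∏ p ∈ z.2, f p := fun z hz => by
    obtain ⟨⟨h1, h2⟩, -⟩ := mem_disjointPairs.mp hz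
    exact mul_nonneg (prod_nonneg fun p hp => hf p (h1 hp)) (prod_nonneg fun p hp => hf p (h2 hp))
  have key : exp a * ∑ z ∈ B, (∏ p ∈ z.1, f p) * ∏ p ∈ z.2, f p ≤
      (∏ p ∈ P, (1 + 2 * f p)) * exp M := by
    calc _ ≤ ∑ z ∈ B, (∏ p ∈ z.1, f p * exp (g p)) * ∏ p ∈ z.2, f p * exp (h p) := by
          rw [mul_sum]
          refine sum_le_sum fun z hz => ?_
          rw [prod_mul_distrib, prod_mul_distrib, ← exp_sum, ← exp_sum]
          calc _ ≤ exp (∑ p ∈ z.1, g p + ∑ p ∈ z.2, h p) *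
                ((∏ p ∈ z.1, f p) * ∏ p ∈ z.2, f p) :=
                mul_le_mul_of_nonneg_right (exp_le_exp.mpr (ha z hz)) (hnn z (hB hz))
            _ = _ := by rw [exp_add]; ring
      _ ≤ ∑ z ∈ disjointPairs P, (∏ p ∈ z.1, f p * exp (g p)) * ∏ p ∈ z.2, f p * exp (h p) := by
          refine sum_le_sum_of_subset_of_nonneg hB fun z hz _ => ?_
          obtain ⟨⟨h1, h2⟩, -⟩ := mem_disjointPairs.mp hz
          exact mul_nonneg (prod_nonneg fun p hp => mul_nonneg (hf p (h1 hp)) (exp_pos _).le)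
            (prod_nonneg fun p hp => mul_nonneg (hf p (h2 hp)) (exp_pos _).le)
      _ = ∏ p ∈ P, (1 + f p * exp (g p) + f p * exp (h p)) := sum_disjointPairs P _ _
      _ ≤ ∏ p ∈ P, ((1 + 2 * f p) * exp (f p * (exp (g p) + exp (h p) - 2))) := by
          refine prod_le_prod (fun p hp => ?_) fun p hp => ?_
          · have := mul_nonneg (hf p hp) (exp_pos (g p)).le
            have := mul_nonneg (hf p hp) (exp_pos (h p)).le
            linarith
          · have h0 := hf p hp
            have h1 : 0 ≤ f p * (exp (g p) + exp (h p) - 2) :=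
              mul_nonneg h0 (by linarith [hgh p hp])
            calc _ ≤ (1 + 2 * f p) * (1 + f p * (exp (g p) + exp (h p) - 2)) := by
                  nlinarith [mul_nonneg h0 h1]
              _ ≤ _ := mul_le_mul_of_nonneg_left
                  (by linarith [add_one_le_exp (f p * (exp (g p) + exp (h p) - 2))]) (by linarith)
      _ ≤ _ := by
          rw [prod_mul_distrib, ← exp_sum]
          exact mul_le_mul_of_nonneg_left (exp_le_exp.mpr hM)
            (prod_nonneg fun p hp => by linarith [hf p hp])
  rw [exp_sub, ← mul_div_assoc, le_div_iff₀ (exp_pos a), mul_comm]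
  exact key

theorem exp_sub_one_le_two_mul {y : ℝ} (h0 : 0 ≤ y) (h1 : y ≤ 1) : exp y - 1 ≤ 2 * y := by
  have := abs_exp_sub_one_sub_id_le (x := y) (by rwa [abs_of_nonneg h0])
  have := (abs_le.mp this).2
  nlinarith

theorem exp_add_exp_neg_le {y : ℝ} (h0 : 0 ≤ y) (h1 : y ≤ 1) :
    exp y + exp (-y) - 2 ≤ 2 * y ^ 2 := by
  have h2 := (abs_le.mp (abs_exp_sub_one_sub_id_le (x := y) (by rwa [abs_of_nonneg h0]))).2
  have h3 := (abs_le.mp (abs_exp_sub_one_sub_id_le (x := -y)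
    (by rwa [abs_neg, abs_of_nonneg h0]))).2
  nlinarith

theorem two_le_exp_add_exp_neg (y : ℝ) : 2 ≤ exp y + exp (-y) := by
  have := one_le_cosh y
  rw [cosh_eq] at this
  linarith

/-- Most of the mass of the pairs of disjoint subsets of `P`, weighted by the product of `f`, lies
on pairs for which both sums of `L` are at most `x` and differ by at most `U`. -/
theorem exists_subset_disjointPairs {P : Finset ℕ} {f L : ℕ → ℝ} {B U x τ : ℝ}
    (hf : ∀ p ∈ P, 0 ≤ f p) (hL : ∀ p ∈ P, 0 ≤ L p ∧ L p ≤ B) (hB : 0 < B) (hτ0 : 0 ≤ τ)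
    (hτ1 : τ ≤ 1) (hU : 2 * τ ^ 2 * ∑ p ∈ P, f p + 3 ≤ τ * U / B)
    (hx : 2 * ∑ p ∈ P, f p + 3 ≤ x / B) :
    ∃ G ⊆ disjointPairs P,
      (∀ z ∈ G, |∑ p ∈ z.1, L p - ∑ p ∈ z.2, L p| ≤ U ∧ ∑ p ∈ z.1, L p ≤ x ∧
        ∑ p ∈ z.2, L p ≤ x) ∧
      (∏ p ∈ P, (1 + 2 * f p)) / 2 ≤ ∑ z ∈ G, (∏ p ∈ z.1, f p) * ∏ p ∈ z.2, f p := by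
  set Z := ∏ p ∈ P, (1 + 2 * f p) with hZ
  set w : Finset ℕ × Finset ℕ → ℝ := fun z => (∏ p ∈ z.1, f p) * ∏ p ∈ z.2, f p with hw
  have hZ0 : 0 ≤ Z := prod_nonneg fun p hp => by linarith [hf p hp]
  have hw0 : ∀ z ∈ disjointPairs P, 0 ≤ w z := fun z hz => by
    obtain ⟨⟨h1, h2⟩, -⟩ := mem_disjointPairs.mp hz
    exact mul_nonneg (prod_nonneg fun p hp => hf p (h1 hp)) (prod_nonneg fun p hp => hf p (h2 hp))
  have htot : ∑ z ∈ disjointPairs P, w z = Z := by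
    rw [hw, sum_disjointPairs, hZ]
    exact prod_congr rfl fun p _ => by ring
  have hy : ∀ p ∈ P, 0 ≤ τ / B * L p ∧ τ / B * L p ≤ τ := fun p hp => by
    refine ⟨mul_nonneg (div_nonneg hτ0 hB.le) (hL p hp).1, ?_⟩
    rw [div_mul_eq_mul_div, div_le_iff₀ hB]
    exact mul_le_mul_of_nonneg_left (hL p hp).2 hτ0
  have hy' : ∀ p ∈ P, 0 ≤ 1 / B * L p ∧ 1 / B * L p ≤ 1 := fun p hp => by
    refine ⟨mul_nonneg (by positivity) (hL p hp).1, ?_⟩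
    rw [div_mul_eq_mul_div, div_le_iff₀ hB]
    linarith [(hL p hp).2]
  have he : exp (-3 : ℝ) ≤ 1 / 8 := by
    have h2 : (2 : ℝ) ≤ exp 1 := by linarith [add_one_le_exp (1 : ℝ)]
    have h8 : (8 : ℝ) ≤ exp 3 := by
      calc (8 : ℝ) = 2 ^ 3 := by norm_num
        _ ≤ exp 1 ^ 3 := pow_le_pow_left₀ (by norm_num) h2 3
        _ = exp 3 := by rw [← exp_nat_mul]; norm_num
    rw [exp_neg, one_div]
    exact inv_anti₀ (by norm_num) h8
  have hfin : ∀ {M a : ℝ}, M + 3 ≤ a → Z * exp (M - a) ≤ Z / 8 := fun {M a} h => by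
    have : exp (M - a) ≤ 1 / 8 := (exp_le_exp.mpr (by linarith)).trans he
    nlinarith
  have hMU : ∑ p ∈ P, f p * (exp (τ / B * L p) + exp (-(τ / B * L p)) - 2) ≤
      2 * τ ^ 2 * ∑ p ∈ P, f p := by
    rw [mul_sum]
    refine sum_le_sum fun p hp => ?_
    obtain ⟨h0, h1⟩ := hy p hp
    have := exp_add_exp_neg_le h0 (h1.trans hτ1)
    have h2 : (τ / B * L p) ^ 2 ≤ τ ^ 2 := pow_le_pow_left₀ h0 h1 2
    nlinarith [hf p hp, mul_le_mul_of_nonneg_left (this.trans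
      (mul_le_mul_of_nonneg_left h2 zero_le_two)) (hf p hp)]
  have hMx : ∑ p ∈ P, f p * (exp (1 / B * L p) + exp 0 - 2) ≤ 2 * ∑ p ∈ P, f p := by
    rw [mul_sum]
    refine sum_le_sum fun p hp => ?_
    obtain ⟨h0, h1⟩ := hy' p hp
    have := exp_sub_one_le_two_mul h0 h1
    rw [exp_zero]
    nlinarith [hf p hp, mul_le_mul_of_nonneg_left (this.trans
      (mul_le_mul_of_nonneg_left h1 zero_le_two)) (hf p hp)]
  have t1 : ∑ z ∈ disjointPairs P with U < ∑ p ∈ z.1, L p - ∑ p ∈ z.2, L p, w z ≤ Z / 8 := by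
    refine (sum_le_prod_mul_exp (filter_subset _ _) hf (g := fun p => τ / B * L p)
      (h := fun p => -(τ / B * L p)) (fun p _ => two_le_exp_add_exp_neg _)
      (a := τ * U / B) (fun z hz => ?_) hMU).trans (hfin hU)
    rw [sum_neg_distrib, ← mul_sum, ← mul_sum, ← sub_eq_add_neg, ← mul_sub,
      mul_div_right_comm]
    exact mul_le_mul_of_nonneg_left (mem_filter.mp hz).2.le (div_nonneg hτ0 hB.le)
  have t2 : ∑ z ∈ disjointPairs P with U < ∑ p ∈ z.2, L p - ∑ p ∈ z.1, L p, w z ≤ Z / 8 := by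
    refine (sum_le_prod_mul_exp (filter_subset _ _) hf (g := fun p => -(τ / B * L p))
      (h := fun p => τ / B * L p)
      (fun p _ => by rw [add_comm]; exact two_le_exp_add_exp_neg _)
      (a := τ * U / B) (fun z hz => ?_) ?_).trans (hfin hU)
    · rw [sum_neg_distrib, ← mul_sum, ← mul_sum, neg_add_eq_sub, ← mul_sub,
        mul_div_right_comm]
      exact mul_le_mul_of_nonneg_left (mem_filter.mp hz).2.le (div_nonneg hτ0 hB.le)
    · simpa only [add_comm] using hMU
  have t3 : ∑ z ∈ disjointPairs P with x < ∑ p ∈ z.1, L p, w z ≤ Z / 8 := by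
    refine (sum_le_prod_mul_exp (filter_subset _ _) hf (g := fun p => 1 / B * L p)
      (h := fun p => 0) (fun p hp => ?_) (a := x / B) (fun z hz => ?_) hMx).trans (hfin hx)
    · have := add_one_le_exp (1 / B * L p)
      rw [exp_zero]
      linarith [(hy' p hp).1]
    · rw [sum_const_zero, add_zero, ← mul_sum, one_div_mul_eq_div]
      exact div_le_div_of_nonneg_right (mem_filter.mp hz).2.le hB.le
  have t4 : ∑ z ∈ disjointPairs P with x < ∑ p ∈ z.2, L p, w z ≤ Z / 8 := by
    refine (sum_le_prod_mul_exp (filter_subset _ _) hf (g := fun p => 0)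
      (h := fun p => 1 / B * L p) (fun p hp => ?_) (a := x / B) (fun z hz => ?_) ?_).trans
      (hfin hx)
    · have := add_one_le_exp (1 / B * L p)
      rw [exp_zero]
      linarith [(hy' p hp).1]
    · rw [sum_const_zero, zero_add, ← mul_sum, one_div_mul_eq_div]
      exact div_le_div_of_nonneg_right (mem_filter.mp hz).2.le hB.le
    · simpa only [add_comm] using hMx
  refine ⟨{z ∈ disjointPairs P | |∑ p ∈ z.1, L p - ∑ p ∈ z.2, L p| ≤ U ∧ ∑ p ∈ z.1, L p ≤ x ∧
    ∑ p ∈ z.2, L p ≤ x}, filter_subset _ _, fun z hz => (mem_filter.mp hz).2, ?_⟩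
  rw [sum_filter] at t1 t2 t3 t4 ⊢
  have hle : Z ≤ ∑ z ∈ disjointPairs P, ((if |∑ p ∈ z.1, L p - ∑ p ∈ z.2, L p| ≤ U ∧
      ∑ p ∈ z.1, L p ≤ x ∧ ∑ p ∈ z.2, L p ≤ x then w z else 0) +
      (if U < ∑ p ∈ z.1, L p - ∑ p ∈ z.2, L p then w z else 0) +
      (if U < ∑ p ∈ z.2, L p - ∑ p ∈ z.1, L p then w z else 0) +
      (if x < ∑ p ∈ z.1, L p then w z else 0) +
      (if x < ∑ p ∈ z.2, L p then w z else 0)) := by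
    rw [← htot]
    refine sum_le_sum fun z hz => ?_
    have h0 := hw0 z hz
    by_cases h : |∑ p ∈ z.1, L p - ∑ p ∈ z.2, L p| ≤ U ∧ ∑ p ∈ z.1, L p ≤ x ∧ ∑ p ∈ z.2, L p ≤ x
    · rw [if_pos h]
      split_ifs <;> linarith
    · rw [if_neg h]
      by_cases h3 : x < ∑ p ∈ z.1, L p
      · rw [if_pos h3]; split_ifs <;> linarith
      by_cases h4 : x < ∑ p ∈ z.2, L p
      · rw [if_pos h4]; split_ifs <;> linarith
      have h5 : ¬ |∑ p ∈ z.1, L p - ∑ p ∈ z.2, L p| ≤ U := fun h5 =>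
        h ⟨h5, not_lt.mp h3, not_lt.mp h4⟩
      rcases lt_abs.mp (not_le.mp h5) with h6 | h6
      · rw [if_pos h6]; split_ifs <;> linarith
      · rw [neg_sub] at h6
        rw [if_pos h6]; split_ifs <;> linarith
  simp only [sum_add_distrib] at hle
  linarith

end DisjointPairs

section LowerBound

open Finset Real

variable {r : ℕ → ℝ}

theorem cast_prod_eq_exp_sum_log {s : Finset ℕ} (hs : ∀ p ∈ s, p.Prime) :
    ((∏ p ∈ s, p : ℕ) : ℝ) = exp (∑ p ∈ s, log (p : ℕ)) := by
  rw [exp_sum, Nat.cast_prod]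
  exact prod_congr rfl fun p hp => (exp_log (Nat.cast_pos.mpr (hs p hp).pos)).symm

theorem IsResonator.map_prod_eq (hr : IsResonator r) {s : Finset ℕ} (hs : ∀ p ∈ s, p.Prime) :
    r (∏ p ∈ s, p) = (∏ p ∈ s, r p / √(p : ℕ)) * exp ((∑ p ∈ s, log (p : ℕ)) / 2) := by
  rw [hr.map_prod hs, exp_half, ← cast_prod_eq_exp_sum_log hs, prod_div_distrib,
    Nat.cast_prod, sqrt_prod _ fun p _ => Nat.cast_nonneg p, div_mul_cancel₀]
  exact (prod_pos fun p hp => sqrt_pos.mpr (Nat.cast_pos.mpr (hs p hp).pos)).ne'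

theorem half_div_le_floor {N M : ℝ} (hM : 0 < M) (h : M ≤ N) : N / 2 / M ≤ ⌊N / M⌋₊ := by
  have h1 : 1 ≤ N / M := (one_le_div hM).mpr h
  have h2 : (1 : ℝ) ≤ ⌊N / M⌋₊ := by exact_mod_cast Nat.le_floor (by exact_mod_cast h1)
  have h3 := Nat.lt_floor_add_one (N / M)
  rw [div_right_comm]
  linarith

theorem IsResonator.sqSum_le_exp_mul (hr : IsResonator r) (T : ℝ) {s : Finset ℕ} {κ C : ℝ}
    (hs : ∀ p ∈ s, p.Prime) (hκ : ∀ p ∈ s, r p ^ 2 ≤ κ) (hC : κ * s.card ≤ C) :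
    sqSum r T ≤ exp C * ∑ g ∈ Icc 1 ⌊T⌋₊ with ∀ p ∈ s, ¬ p ∣ g, r g ^ 2 := by
  refine (hr.sqSum_le_prod_mul_sum_coprime T hs).trans
    (mul_le_mul_of_nonneg_right ?_ (sum_nonneg fun _ _ => sq_nonneg _))
  calc ∏ p ∈ s, (1 + r p ^ 2) ≤ ∏ p ∈ s, exp κ :=
        prod_le_prod (fun p _ => by positivity) fun p hp => by
          linarith [hκ p hp, add_one_le_exp κ]
    _ = exp (s.card * κ) := by rw [prod_const, ← exp_nat_mul]
    _ ≤ exp C := exp_le_exp.mpr (by linarith)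

/-- A lower bound for the resonator numerator by the product of `1 + 2 * r p / √p` over a set `P`
of primes. -/
theorem IsResonator.prod_mul_sqSum_le_ratioSum (hr : IsResonator r) {P : Finset ℕ}
    {Y N B U x τ κ l : ℝ} (hP : ∀ p ∈ P, p.Prime) (hY : 0 ≤ Y) (hB : 0 < B) (hτ0 : 0 ≤ τ)
    (hτ1 : τ ≤ 1) (hl : 0 < l) (hκ0 : 0 ≤ κ) (hκ : ∀ p ∈ P, r p ^ 2 ≤ κ)
    (hPl : ∀ p ∈ P, l ≤ log (p : ℕ) ∧ log (p : ℕ) ≤ B)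
    (hU : 2 * τ ^ 2 * ∑ p ∈ P, r p / √(p : ℕ) + 3 ≤ τ * U / B)
    (hx : 2 * ∑ p ∈ P, r p / √(p : ℕ) + 3 ≤ x / B) (hN : exp x ≤ N) :
    N / 4 * (∏ p ∈ P, (1 + 2 * (r p / √(p : ℕ)))) * exp (-(U / 2)) * exp (-(2 * κ * x / l)) *
      sqSum r (Y * exp (-x)) ≤ ratioSum r Y N := by
  have hf : ∀ p ∈ P, 0 ≤ r p / √(p : ℕ) := fun p hp =>
    div_nonneg (hr.prime_nonneg p (hP p hp)) (sqrt_nonneg _)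
  obtain ⟨G, hGP, hG, hGsum⟩ := exists_subset_disjointPairs (L := fun p => log (p : ℕ)) hf
    (fun p hp => ⟨hl.le.trans (hPl p hp).1, (hPl p hp).2⟩) hB hτ0 hτ1 hU hx
  have hN0 : 0 < N := (exp_pos x).trans_le hN
  have hmem : ∀ z ∈ G, (∀ p ∈ z.1, p.Prime) ∧ (∀ p ∈ z.2, p.Prime) ∧ Disjoint z.1 z.2 :=
    fun z hz => by
      obtain ⟨⟨h1, h2⟩, h3⟩ := mem_disjointPairs.mp (hGP hz)
      exact ⟨fun p hp => hP p (h1 hp), fun p hp => hP p (h2 hp), h3⟩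
  set M : Finset ℕ × Finset ℕ → ℝ := fun z =>
    exp (max (∑ p ∈ z.1, log (p : ℕ)) (∑ p ∈ z.2, log (p : ℕ))) with hM
  have hMN : ∀ z ∈ G, M z ≤ N := fun z hz =>
    (exp_le_exp.mpr (max_le (hG z hz).2.1 (hG z hz).2.2)).trans hN
  have hfl : ∀ z, ⌊N / M z⌋₊ * M z ≤ N := fun z => by
    rw [← le_div_iff₀ (exp_pos _)]
    exact Nat.floor_le (div_nonneg hN0.le (exp_pos _).le)
  have hT : ∀ A : ℝ, A ≤ x → Y * exp (-x) * exp A ≤ Y := fun A hA => by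
    rw [mul_assoc, ← exp_add]
    exact mul_le_of_le_one_right hY (exp_le_one_iff.mpr (by linarith))
  refine le_trans ?_ (hr.le_ratioSum (Y := Y) (N := N) (T := Y * exp (-x)) (G := G)
    (k := fun z => ⌊N / M z⌋₊) hmem (fun z hz => ?_) fun z hz => ?_)
  · rw [show N / 4 * (∏ p ∈ P, (1 + 2 * (r p / √(p : ℕ)))) * exp (-(U / 2)) *
      exp (-(2 * κ * x / l)) * sqSum r (Y * exp (-x)) =
      ((∏ p ∈ P, (1 + 2 * (r p / √(p : ℕ)))) / 2) * (N / 2 * exp (-(U / 2)) *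
      (exp (-(2 * κ * x / l)) * sqSum r (Y * exp (-x)))) by ring]
    have hD := sqSum_nonneg (r := r) (Y * exp (-x))
    refine (mul_le_mul_of_nonneg_right hGsum (by positivity)).trans ?_
    rw [sum_mul]
    refine sum_le_sum fun z hz => ?_
    obtain ⟨h1, h2, -⟩ := hmem z hz
    obtain ⟨⟨s1, s2⟩, -⟩ := mem_disjointPairs.mp (hGP hz)
    obtain ⟨g1, g2, g3⟩ := hG z hz
    have hcard : ∀ s ⊆ P, ∑ p ∈ s, log (p : ℕ) ≤ x → κ * s.card ≤ κ * x / l := fun s hs hsx => by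
      rw [mul_div_assoc]
      refine mul_le_mul_of_nonneg_left ?_ hκ0
      rw [le_div_iff₀ hl, ← nsmul_eq_mul]
      exact (card_nsmul_le_sum s _ l fun p hp => (hPl p (hs hp)).1).trans hsx
    have hin : exp (-(2 * κ * x / l)) * sqSum r (Y * exp (-x)) ≤
        ∑ g ∈ Icc 1 ⌊Y * exp (-x)⌋₊ with ∀ p ∈ z.1 ∪ z.2, ¬ p ∣ g, r g ^ 2 := by
      rw [exp_neg, inv_mul_le_iff₀ (exp_pos _)]
      refine hr.sqSum_le_exp_mul _ (fun p hp => ?_) (κ := κ) (fun p hp => ?_) ?_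
      · exact (mem_union.mp hp).elim (h1 p) (h2 p)
      · exact hκ p ((mem_union.mp hp).elim (@s1 p) (@s2 p))
      · have hc : ((z.1 ∪ z.2).card : ℝ) ≤ z.1.card + z.2.card := by
          exact_mod_cast card_union_le _ _
        calc κ * ((z.1 ∪ z.2).card : ℝ) ≤ κ * (z.1.card + z.2.card) :=
              mul_le_mul_of_nonneg_left hc hκ0
          _ ≤ κ * x / l + κ * x / l := by
              rw [mul_add]
              exact add_le_add (hcard _ s1 g2) (hcard _ s2 g3)
          _ = _ := by ring
    have hk : N / 2 * exp (-(U / 2)) ≤ ⌊N / M z⌋₊ * (exp ((∑ p ∈ z.1, log (p : ℕ)) / 2) *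
        exp ((∑ p ∈ z.2, log (p : ℕ)) / 2)) := by
      refine le_trans ?_ (mul_le_mul_of_nonneg_right
        (half_div_le_floor (exp_pos _) (hMN z hz)) (by positivity))
      rw [div_mul_eq_mul_div _ (M z), mul_div_assoc]
      refine mul_le_mul_of_nonneg_left ?_ (by positivity)
      rw [hM, ← exp_add, ← exp_sub, exp_le_exp]
      have := max_sub_min_eq_abs (∑ p ∈ z.1, log (p : ℕ)) (∑ p ∈ z.2, log (p : ℕ))
      have := max_add_min (∑ p ∈ z.1, log (p : ℕ)) (∑ p ∈ z.2, log (p : ℕ))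
      rw [abs_sub_comm] at g1
      linarith
    rw [hr.map_prod_eq h1, hr.map_prod_eq h2]
    have hw : 0 ≤ (∏ p ∈ z.1, r p / √(p : ℕ)) * ∏ p ∈ z.2, r p / √(p : ℕ) :=
      mul_nonneg (prod_nonneg fun p hp => hf p (s1 hp)) (prod_nonneg fun p hp => hf p (s2 hp))
    calc _ ≤ ((∏ p ∈ z.1, r p / √(p : ℕ)) * ∏ p ∈ z.2, r p / √(p : ℕ)) *
          ((⌊N / M z⌋₊ * (exp ((∑ p ∈ z.1, log (p : ℕ)) / 2) *
          exp ((∑ p ∈ z.2, log (p : ℕ)) / 2))) *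
          ∑ g ∈ Icc 1 ⌊Y * exp (-x)⌋₊ with ∀ p ∈ z.1 ∪ z.2, ¬ p ∣ g, r g ^ 2) :=
          mul_le_mul_of_nonneg_left (mul_le_mul hk hin
            (mul_nonneg (exp_pos _).le (sqSum_nonneg _)) (by positivity)) hw
      _ = _ := by ring
  · obtain ⟨h1, h2, -⟩ := hmem z hz
    rw [cast_prod_eq_exp_sum_log h1, cast_prod_eq_exp_sum_log h2]
    exact ⟨hT _ (hG z hz).2.1, hT _ (hG z hz).2.2⟩
  · obtain ⟨h1, h2, -⟩ := hmem z hz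
    rw [cast_prod_eq_exp_sum_log h1, cast_prod_eq_exp_sum_log h2]
    exact ⟨(mul_le_mul_of_nonneg_left (exp_le_exp.mpr (le_max_left _ _))
      (Nat.cast_nonneg _)).trans (hfl z), (mul_le_mul_of_nonneg_left
      (exp_le_exp.mpr (le_max_right _ _)) (Nat.cast_nonneg _)).trans (hfl z)⟩

end LowerBound

section Asymptotics

open Finset Real Filter

variable {r : ℕ → ℝ}

theorem eventually_mul_log_pow_le (C : ℝ) (k : ℕ) : ∀ᶠ v : ℝ in atTop, C * log v ^ k ≤ v := by
  have h := (isLittleO_pow_log_id_atTop (n := k)).bound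
    (show (0 : ℝ) < 1 / (|C| + 1) by positivity)
  filter_upwards [h, eventually_ge_atTop 1] with v hv h1
  have h2 : 0 ≤ log v ^ k := pow_nonneg (log_nonneg h1) k
  rw [norm_of_nonneg h2, id, norm_of_nonneg (by linarith), one_div_mul_eq_div,
    le_div_iff₀ (by positivity)] at hv
  nlinarith [le_abs_self C]

theorem eventually_mul_log_le_rpow (C : ℝ) {η : ℝ} (hη : 0 < η) :
    ∀ᶠ v : ℝ in atTop, C * log v ≤ v ^ η := by
  have h := (isLittleO_log_rpow_atTop hη).bound (show (0 : ℝ) < 1 / (|C| + 1) by positivity)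
  filter_upwards [h, eventually_ge_atTop 1] with v hv h1
  have h2 : 0 ≤ log v := log_nonneg h1
  rw [norm_of_nonneg h2, norm_of_nonneg (by positivity), one_div_mul_eq_div,
    le_div_iff₀ (by positivity)] at hv
  nlinarith [le_abs_self C]

/-- The resonator of parameter `v` takes the value `v / (√p * log p)` at the primes `p` of
`[v, exp ((log v) ^ 2)]`, and vanishes at the other primes. -/
structure IsResonatorWith (v : ℝ) (r : ℕ → ℝ) : Prop extends IsResonator r where
  prime_eq : ∀ p : ℕ, p.Prime → r p =
    if v ≤ (p : ℝ) ∧ (p : ℝ) ≤ exp (log v ^ 2) then v / (√p * log p) else 0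

theorem IsResonatorWith.le_of_ne_zero {v : ℝ} (hr : IsResonatorWith v r) {p : ℕ} (hp : p.Prime)
    (h : r p ≠ 0) : (p : ℝ) ≤ exp (log v ^ 2) := by
  by_contra hlt
  exact h (by rw [hr.prime_eq p hp, if_neg fun h' => hlt h'.2])

theorem IsResonatorWith.sq_mul_log_le {v : ℝ} (hr : IsResonatorWith v r) {p : ℕ} (hp : p.Prime) :
    r p ^ 2 * log p ≤ v ^ 2 * (1 / (p * log p)) := by
  have hp1 : (1 : ℝ) < p := by exact_mod_cast hp.one_lt
  have hl : 0 < log (p : ℝ) := log_pos hp1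
  rw [hr.prime_eq p hp]
  split_ifs
  · rw [div_pow, mul_pow, sq_sqrt (by linarith)]
    refine le_of_eq ?_
    field_simp
  · rw [zero_pow two_ne_zero, zero_mul]
    positivity

theorem exp_neg_two_mul_le_one_sub {y : ℝ} (h0 : 0 ≤ y) (h1 : y ≤ 1 / 2) :
    exp (-(2 * y)) ≤ 1 - y := by
  rw [exp_neg, inv_le_comm₀ (exp_pos _) (by linarith), inv_le_iff_one_le_mul₀ (by linarith)]
  nlinarith [add_one_le_exp (2 * y), mul_le_mul_of_nonneg_right (add_one_le_exp (2 * y))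
    (show 0 ≤ 1 - y by linarith)]

theorem eventually_exp_mul_sqSum_le {K δ : ℝ} (hK : 1 ≤ K) (hδ : 0 < δ) (hδ1 : δ ≤ 1) :
    ∀ᶠ v : ℝ in atTop, ∀ (r : ℕ → ℝ) (Y : ℝ), IsResonatorWith v r → 1 < Y →
      v ^ 2 / (2 * log v) ≤ log Y →
      exp (-(δ * (v / log v))) * sqSum r Y ≤ sqSum r (Y * exp (-(3 * K * v))) := by
  set d : ℝ := δ / (48 * K) with hd
  have hK0 : 0 < K := by linarith
  have hd0 : 0 < d := by positivity
  have hdK : 48 * K * d = δ := by rw [hd]; field_simp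
  have hd8 : d ≤ 1 / 48 := by nlinarith
  obtain ⟨z₀, hz₀⟩ := exists_sum_one_div_mul_log_le (δ := d / 4) (by positivity)
  have hη : 0 < d / 4 := by positivity
  have hz : Tendsto (fun v : ℝ => v ^ (2 - d / 4)) atTop atTop :=
    tendsto_rpow_atTop (by linarith)
  filter_upwards [hz.eventually_ge_atTop (max z₀ 1), eventually_gt_atTop 1,
    eventually_mul_log_le_rpow (2 * log 4 / d) hη, eventually_mul_log_pow_le (6 * K / d) 1,
    eventually_mul_log_pow_le ((1 + |log d|) / (δ / 2)) 1,
    tendsto_log_atTop.eventually_ge_atTop 1] with v h1 hv1 h2 h3 h4 hw1 r Y hr hY hlogY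
  obtain ⟨hz0, hz1⟩ := max_le_iff.mp h1
  set w := log v with hw
  set z := v ^ (2 - d / 4) with hzdef
  have hv0 : 0 < v := by linarith
  have hw0 : 0 < w := by linarith
  have hlogz : log z = (2 - d / 4) * w := by rw [hzdef, log_rpow hv0]
  have hwz : w ≤ log z := by rw [hlogz]; nlinarith
  have hJ : exp (3 * K * v) ≤ z ^ ⌈3 * K * v / w⌉₊ := by
    have : exp (3 * K * v) ≤ exp (⌈3 * K * v / w⌉₊ * log z) := by
      rw [exp_le_exp]
      calc 3 * K * v = 3 * K * v / w * w := by field_simp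
        _ ≤ _ := mul_le_mul (Nat.le_ceil _) hwz hw0.le (Nat.cast_nonneg _)
    rwa [exp_nat_mul, exp_log (by linarith)] at this
  have hxY : 3 * K * v ≤ d * log Y := by
    refine le_trans ?_ (mul_le_mul_of_nonneg_left hlogY hd0.le)
    rw [pow_one, div_mul_eq_mul_div, div_le_iff₀ hd0] at h3
    rw [← mul_div_assoc, le_div_iff₀ (by positivity)]
    nlinarith
  have hzY : log 4 * z ≤ d * log Y := by
    refine le_trans ?_ (mul_le_mul_of_nonneg_left hlogY hd0.le)
    have hvz : v ^ 2 = z * v ^ (d / 4) := by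
      rw [hzdef, ← rpow_add hv0, sub_add_cancel]
      exact_mod_cast (rpow_natCast v 2).symm
    rw [div_mul_eq_mul_div, div_le_iff₀ hd0] at h2
    rw [← mul_div_assoc, le_div_iff₀ (by positivity), hvz]
    nlinarith
  have hW : ∑ p ∈ range (⌊exp (w ^ 2)⌋₊ + 1) with Nat.Prime p ∧ z ≤ (p : ℕ),
      r p ^ 2 * log (p : ℕ) ≤ (1 + d) * log Y := by
    calc _ ≤ ∑ p ∈ range (⌊exp (w ^ 2)⌋₊ + 1) with Nat.Prime p ∧ z ≤ (p : ℕ),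
          v ^ 2 * (1 / ((p : ℕ) * log (p : ℕ) : ℝ)) :=
          sum_le_sum fun p hp => hr.sq_mul_log_le (mem_filter.mp hp).2.1
      _ ≤ v ^ 2 * ((1 + d / 4) / log z) := by
          rw [← mul_sum]
          exact mul_le_mul_of_nonneg_left (hz₀ z hz0 _) (sq_nonneg v)
      _ ≤ (1 + d) * (v ^ 2 / (2 * w)) := by
          rw [hlogz, ← mul_div_assoc, ← mul_div_assoc, div_le_div_iff₀ (by nlinarith) (by linarith)]
          have : (1 + d / 4) * 2 ≤ (1 + d) * (2 - d / 4) := by nlinarith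
          nlinarith [mul_le_mul_of_nonneg_left this (by positivity : 0 ≤ v ^ 2 * w)]
      _ ≤ _ := mul_le_mul_of_nonneg_left hlogY (by linarith)
  have hshift := hr.toIsResonator.le_sqSum_shift hz1 hd0 (by linarith) (by positivity) hY hxY hzY
    (fun p hp hzp hrp => mem_filter.mpr ⟨mem_range.mpr (Nat.lt_succ_of_le
      (Nat.le_floor (hr.le_of_ne_zero hp hrp))), hp, hzp⟩)
    (fun p hp => (mem_filter.mp hp).2) hW hJ
  refine le_trans (mul_le_mul_of_nonneg_right ?_ (sqSum_nonneg Y)) hshift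
  have hpow : exp (-(2 * (4 * d))) ^ ⌈3 * K * v / w⌉₊ ≤ (1 - 4 * d) ^ ⌈3 * K * v / w⌉₊ :=
    pow_le_pow_left₀ (exp_pos _).le (exp_neg_two_mul_le_one_sub (by linarith) (by linarith)) _
  refine le_trans ?_ (mul_le_mul_of_nonneg_left hpow hd0.le)
  suffices h : exp (-(δ * (v / w))) ≤
      exp (log d) * exp (⌈3 * K * v / w⌉₊ * -(2 * (4 * d))) by
    rwa [exp_log hd0, exp_nat_mul] at h
  rw [← exp_add, exp_le_exp]
  have hceil := Nat.ceil_lt_add_one (show 0 ≤ 3 * K * v / w by positivity)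
  have h5 : 1 + |log d| ≤ δ / 2 * (v / w) := by
    rw [pow_one, div_mul_eq_mul_div, div_le_iff₀ (by positivity)] at h4
    rw [← mul_div_assoc, le_div_iff₀ hw0]
    linarith
  have h6 : 8 * d * (3 * K * v / w) = δ / 2 * (v / w) := by
    rw [← hdK]; ring
  have h7 := neg_abs_le (log d)
  nlinarith

/-- The primes `p` with `z ≤ p ≤ W`. -/
def primeRange (z W : ℝ) : Finset ℕ := {p ∈ range (⌊W⌋₊ + 1) | p.Prime ∧ z ≤ (p : ℕ)}

theorem IsResonatorWith.mem_primeRange {v K : ℝ} (hr : IsResonatorWith v r) (hv : 1 < v)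
    (hw : 1 ≤ log v) (hK : K ≤ log v) {p : ℕ} (hp : p ∈ primeRange (v ^ 2) (exp (K * log v))) :
    p.Prime ∧ 2 * log v ≤ log p ∧ log p ≤ K * log v ∧ r p ^ 2 ≤ 1 / (4 * log v ^ 2) ∧
      r p / √p = v * (1 / (p * log p)) ∧ r p / √p ≤ 1 / v := by
  obtain ⟨hpr, hpp, hvp⟩ := mem_filter.mp hp
  have hv0 : 0 < v := by linarith
  have hp0 : (0 : ℝ) < p := Nat.cast_pos.mpr hpp.pos
  have hpK : (p : ℝ) ≤ exp (K * log v) :=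
    (Nat.le_floor_iff (exp_pos _).le).mp (Nat.lt_succ_iff.mp (mem_range.mp hpr))
  have h2 : 2 * log v ≤ log p := by
    have := log_le_log (by positivity) hvp
    rwa [log_pow, Nat.cast_two] at this
  have h3 : log (p : ℝ) ≤ K * log v := by
    have := log_le_log hp0 hpK
    rwa [log_exp] at this
  have hl : 0 < log (p : ℝ) := by linarith
  have hrp : r p = v / (√p * log p) := by
    rw [hr.prime_eq p hpp, if_pos ⟨by nlinarith, hpK.trans (exp_le_exp.mpr (by nlinarith))⟩]
  have hf : r p / √p = v * (1 / (p * log p)) := by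
    have := mul_self_sqrt hp0.le
    rw [hrp, div_div, mul_right_comm, this, mul_one_div]
  refine ⟨hpp, h2, h3, ?_, hf, ?_⟩
  · rw [hrp, div_pow, mul_pow, sq_sqrt hp0.le, div_le_div_iff₀ (by positivity) (by positivity),
      one_mul]
    have h4 : (2 * log v) ^ 2 ≤ log (p : ℝ) ^ 2 := pow_le_pow_left₀ (by linarith) h2 2
    calc v ^ 2 * (4 * log v ^ 2) = v ^ 2 * (2 * log v) ^ 2 := by ring
      _ ≤ _ := mul_le_mul hvp h4 (sq_nonneg _) hp0.le
  · rw [hf, mul_one_div, div_le_div_iff₀ (by positivity) hv0, one_mul]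
    nlinarith [mul_le_mul hvp (by linarith : (1 : ℝ) ≤ log p) zero_le_one hp0.le]

theorem one_sub_mul_le_log_one_add {f δ : ℝ} (hf : 0 ≤ f) (hfδ : f ≤ δ) :
    (1 - δ) * (2 * f) ≤ log (1 + 2 * f) := by
  refine le_trans ?_ (le_log_one_add_of_nonneg (by linarith))
  rw [le_div_iff₀ (by linarith)]
  nlinarith [mul_nonneg hf (by linarith : 0 ≤ δ - f), mul_nonneg (mul_nonneg hf hf) (hf.trans hfδ)]

theorem eventually_sum_primeRange {K δ : ℝ} (hK : 2 ≤ K) (hδ : 0 < δ) :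
    ∀ᶠ v : ℝ in atTop, ∀ r : ℕ → ℝ, IsResonatorWith v r →
      ∑ p ∈ primeRange (v ^ 2) (exp (K * log v)), r p / √(p : ℕ) ≤ v / log v ∧
      exp ((1 - 2 / K - 3 * δ) * (v / log v)) ≤
        ∏ p ∈ primeRange (v ^ 2) (exp (K * log v)), (1 + 2 * (r p / √(p : ℕ))) := by
  obtain ⟨z₁, hz₁⟩ := exists_sum_one_div_mul_log_le one_pos
  obtain ⟨z₂, hz₂⟩ := exists_le_sum_one_div_mul_log hδ
  filter_upwards [eventually_ge_atTop (max (max z₁ z₂) (1 / δ)), eventually_gt_atTop 1,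
    tendsto_log_atTop.eventually_ge_atTop K] with v hvz hv1 hKw r hr
  obtain ⟨hvz', hvδ⟩ := max_le_iff.mp hvz
  obtain ⟨hvz1, hvz2⟩ := max_le_iff.mp hvz'
  set w := log v with hw
  have hv0 : 0 < v := by linarith
  have hw0 : 0 < w := by linarith
  have hvv : v ≤ v ^ 2 := by nlinarith
  have hlog : log (v ^ 2) = 2 * w := by rw [log_pow, Nat.cast_two]
  have hmem := fun p hp => hr.mem_primeRange (p := p) (K := K) hv1 (by linarith) hKw hp
  set P := primeRange (v ^ 2) (exp (K * w)) with hP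
  have hsum : ∑ p ∈ P, r p / √(p : ℕ) = v * ∑ p ∈ P, 1 / ((p : ℕ) * log (p : ℕ) : ℝ) := by
    rw [mul_sum]
    exact sum_congr rfl fun p hp => (hmem p hp).2.2.2.2.1
  have hup : ∑ p ∈ P, r p / √(p : ℕ) ≤ v / w := by
    have := hz₁ (v ^ 2) (hvz1.trans hvv) ⌊exp (K * w)⌋₊
    rw [hlog, show (1 + 1) / (2 * w) = 1 / w by field_simp; norm_num] at this
    rw [hsum, div_eq_mul_one_div v w]
    exact mul_le_mul_of_nonneg_left this hv0.le
  have hlow : (1 - δ - 2 / K) * (v / w) ≤ 2 * ∑ p ∈ P, r p / √(p : ℕ) := by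
    have hle : v ^ 2 ≤ exp (K * w) := by
      rw [← exp_log (show 0 < v ^ 2 by positivity), hlog]
      exact exp_le_exp.mpr (by nlinarith)
    have := hz₂ (v ^ 2) (hvz2.trans hvv) _ hle
    rw [hlog, log_exp] at this
    rw [hsum]
    calc _ = 2 * (v * ((1 - δ) / (2 * w) - 1 / (K * w))) := by
          have : K ≠ 0 := by linarith
          field_simp
      _ ≤ _ := mul_le_mul_of_nonneg_left (mul_le_mul_of_nonneg_left this hv0.le) zero_le_two
  refine ⟨hup, ?_⟩
  have hf0 : ∀ p ∈ P, 0 ≤ r p / √(p : ℕ) := fun p hp =>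
    div_nonneg (hr.prime_nonneg p (hmem p hp).1) (sqrt_nonneg _)
  have hfδ : ∀ p ∈ P, r p / √(p : ℕ) ≤ δ := fun p hp => (hmem p hp).2.2.2.2.2.trans <| by
    rw [one_div_le hv0 hδ]; exact hvδ
  calc _ ≤ exp (∑ p ∈ P, (1 - δ) * (2 * (r p / √(p : ℕ)))) := by
        rw [exp_le_exp, ← mul_sum, ← mul_sum]
        nlinarith
    _ ≤ exp (∑ p ∈ P, log (1 + 2 * (r p / √(p : ℕ)))) :=
        exp_le_exp.mpr (sum_le_sum fun p hp => one_sub_mul_le_log_one_add (hf0 p hp) (hfδ p hp))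
    _ = _ := by
        rw [exp_sum]
        exact prod_congr rfl fun p hp => exp_log (by linarith [hf0 p hp])

theorem eventually_mul_sqSum_le_ratioSum {ε : ℝ} (hε : 0 < ε) (hε1 : ε ≤ 1) :
    ∀ᶠ v : ℝ in atTop, ∀ (r : ℕ → ℝ) (Y N : ℝ), IsResonatorWith v r → 1 < Y →
      v ^ 2 / (2 * log v) ≤ log Y → 0 < N → 3 * v * log (log v) < log N →
      N * exp ((1 - ε / 4) * (v / log v)) * sqSum r Y ≤ ratioSum r Y N := by
  obtain ⟨K, hK⟩ : ∃ K, K = 16 / ε := ⟨_, rfl⟩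
  obtain ⟨δ, hδ⟩ : ∃ δ, δ = ε / 64 := ⟨_, rfl⟩
  have hK16 : 16 ≤ K := by rw [hK, le_div_iff₀ hε]; linarith
  have hδ0 : 0 < δ := by rw [hδ]; positivity
  have hKε : 2 / K = ε / 8 := by rw [hK]; field_simp; norm_num
  filter_upwards [eventually_exp_mul_sqSum_le (by linarith : 1 ≤ K) hδ0 (by linarith),
    eventually_sum_primeRange (by linarith : 2 ≤ K) hδ0, eventually_gt_atTop 1,
    eventually_mul_log_pow_le (24 * K ^ 2 / δ ^ 2) 3, eventually_mul_log_pow_le 3 1,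
    eventually_mul_log_pow_le (2 / δ) 1,
    tendsto_log_atTop.eventually_ge_atTop (max K (3 * K / (4 * δ))),
    (tendsto_log_atTop.comp tendsto_log_atTop).eventually_ge_atTop K]
    with v hshift hsum hv1 hv3 hv4 hv5 hwm hww r Y N hr hY hlogY hN0 hN
  obtain ⟨hwK, hwδ⟩ := max_le_iff.mp hwm
  obtain ⟨hσ, hprod⟩ := hsum r hr
  have hsh := hshift r Y hr hY hlogY
  have hmem := fun p hp => hr.mem_primeRange (p := p) (K := K) hv1 (by linarith) hwK hp
  rw [Function.comp_apply] at hww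
  set w := log v with hw
  set q := v / w with hq
  set P := primeRange (v ^ 2) (exp (K * w)) with hP
  have hv0 : 0 < v := by linarith
  have hw0 : 0 < w := by linarith
  have hvq : v = q * w := by rw [hq]; field_simp
  have hq0 : 0 < q := by positivity
  have hq3 : 3 ≤ q := by rw [hq, le_div_iff₀ hw0]; linarith
  have hq2 : 2 ≤ δ * q := by
    rw [hq, ← mul_div_assoc, le_div_iff₀ hw0]
    rw [pow_one, div_mul_eq_mul_div, div_le_iff₀ hδ0] at hv5
    linarith
  have hqw : 3 ≤ δ ^ 2 / (8 * K ^ 2 * w ^ 2) * q := by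
    rw [div_mul_eq_mul_div, div_le_iff₀ (by positivity)] at hv3
    rw [div_mul_eq_mul_div, le_div_iff₀ (by positivity)]
    have : 24 * K ^ 2 * w ^ 2 * w ≤ δ ^ 2 * q * w := by rw [mul_assoc _ q w, ← hvq]; linarith
    linarith [le_of_mul_le_mul_right this hw0]
  have hτ : δ / (4 * K * w) ≤ 1 := by
    rw [div_le_one (by positivity)]
    nlinarith
  have hNx : exp (3 * K * v) ≤ N := by
    rw [← exp_log hN0, exp_le_exp]
    nlinarith
  have hmain := hr.toIsResonator.prod_mul_sqSum_le_ratioSum (P := P) (Y := Y) (N := N)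
    (B := K * w) (U := δ * q) (x := 3 * K * v) (τ := δ / (4 * K * w)) (κ := 1 / (4 * w ^ 2))
    (l := 2 * w) (fun p hp => (hmem p hp).1) (by linarith) (by positivity) (by positivity) hτ
    (by positivity) (by positivity) (fun p hp => (hmem p hp).2.2.2.1)
    (fun p hp => ⟨(hmem p hp).2.1, (hmem p hp).2.2.1⟩) ?_ ?_ hNx
  · refine le_trans ?_ hmain
    have h4 : exp (-(δ * q)) ≤ 1 / 4 := by
      rw [exp_neg, one_div]
      refine inv_anti₀ (by norm_num) ?_
      have h1 : (2 : ℝ) ≤ exp 1 := by linarith [add_one_le_exp (1 : ℝ)]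
      calc (4 : ℝ) ≤ exp 1 ^ 2 := by nlinarith
        _ = exp 2 := by rw [← exp_nat_mul]; norm_num
        _ ≤ _ := exp_le_exp.mpr hq2
    have hκ : exp (-(δ * q)) ≤ exp (-(2 * (1 / (4 * w ^ 2)) * (3 * K * v) / (2 * w))) := by
      rw [exp_le_exp, neg_le_neg_iff]
      have h1 : 2 * (1 / (4 * w ^ 2)) * (3 * K * v) / (2 * w) = 3 * K / (4 * w ^ 2) * q := by
        rw [hq]; field_simp
      rw [h1]
      refine mul_le_mul_of_nonneg_right ?_ hq0.le
      rw [div_le_iff₀ (by positivity)] at hwδ ⊢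
      have hww2 : w ≤ w ^ 2 := le_self_pow₀ (by linarith) two_ne_zero
      linarith [mul_le_mul_of_nonneg_right hww2 (by positivity : 0 ≤ 4 * δ)]
    have hexp : exp ((1 - ε / 4) * q) ≤ exp (-(δ * q)) * exp ((1 - 2 / K - 3 * δ) * q) *
        exp (-(δ * q / 2)) * exp (-(δ * q)) * exp (-(δ * q)) := by
      rw [← exp_add, ← exp_add, ← exp_add, ← exp_add, exp_le_exp, hKε, hδ]
      linarith [mul_pos hε hq0]
    have hS := sqSum_nonneg (r := r) Y
    have hZ : 0 ≤ ∏ p ∈ P, (1 + 2 * (r p / √(p : ℕ))) := (exp_pos _).le.trans hprod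
    generalize ∏ p ∈ P, (1 + 2 * (r p / √(p : ℕ))) = Z at hprod hZ ⊢
    calc N * exp ((1 - ε / 4) * q) * sqSum r Y
        ≤ N * (exp (-(δ * q)) * exp ((1 - 2 / K - 3 * δ) * q) *
          exp (-(δ * q / 2)) * exp (-(δ * q)) * exp (-(δ * q))) * sqSum r Y := by gcongr
      _ = N * (exp (-(δ * q)) * exp ((1 - 2 / K - 3 * δ) * q) *
          exp (-(δ * q / 2)) * exp (-(δ * q))) * (exp (-(δ * q)) * sqSum r Y) := by ring
      _ ≤ N * (1 / 4 * Z * exp (-(δ * q / 2)) *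
          exp (-(2 * (1 / (4 * w ^ 2)) * (3 * K * v) / (2 * w)))) *
          sqSum r (Y * exp (-(3 * K * v))) := by gcongr
      _ = _ := by ring
  · have h1 : δ / (4 * K * w) * (δ * q) / (K * w) =
        2 * (δ ^ 2 / (8 * K ^ 2 * w ^ 2) * q) := by field_simp; norm_num
    have h2 : 2 * (δ / (4 * K * w)) ^ 2 = δ ^ 2 / (8 * K ^ 2 * w ^ 2) := by
      field_simp; norm_num
    rw [h1, h2]
    have := mul_le_mul_of_nonneg_left hσ (by positivity : 0 ≤ δ ^ 2 / (8 * K ^ 2 * w ^ 2))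
    linarith
  · have h1 : 3 * K * v / (K * w) = 3 * q := by rw [hq]; field_simp
    rw [h1]
    linarith

theorem log_lam {Y : ℝ} (hY : 0 < log Y) (hl : 0 < log (log Y)) :
    log (lam Y) = (log (log Y) + log (log (log Y))) / 2 := by
  rw [lam, log_sqrt (mul_pos hY hl).le, log_mul hY.ne' hl.ne']

theorem tendsto_lam_atTop : Tendsto lam atTop atTop :=
  tendsto_sqrt_atTop.comp (tendsto_log_atTop.atTop_mul_atTop₀
    (tendsto_log_atTop.comp tendsto_log_atTop))

theorem eventually_sqrt_log_div_le {ε : ℝ} (hε : 0 < ε) :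
    ∀ᶠ Y : ℝ in atTop, lam Y ^ 2 / (2 * log (lam Y)) ≤ log Y ∧
      (2 - ε) * √(log Y / log (log Y)) ≤ (1 - ε / 4) * (lam Y / log (lam Y)) := by
  have h2 : Tendsto (fun Y : ℝ => log (log Y)) atTop atTop :=
    tendsto_log_atTop.comp tendsto_log_atTop
  filter_upwards [tendsto_log_atTop.eventually_gt_atTop 0, h2.eventually_ge_atTop 1,
    h2.eventually (eventually_mul_log_pow_le (8 / ε) 1)] with Y hY hl hll
  have hl0 : 0 < log (log Y) := by linarith
  have hlog := log_lam hY hl0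
  have hlll := log_nonneg hl
  have hsq : lam Y ^ 2 = log Y * log (log Y) := sq_sqrt (mul_pos hY hl0).le
  have hlam : 0 ≤ lam Y := sqrt_nonneg _
  have hR : √(log Y / log (log Y)) = lam Y / log (log Y) := by
    rw [sqrt_eq_iff_mul_self_eq (by positivity) (by positivity), div_mul_div_comm, ← sq, hsq]
    field_simp
  rw [pow_one, div_mul_eq_mul_div, div_le_iff₀ hε] at hll
  rw [hR, hsq, hlog]
  generalize log (log (log Y)) = m at *
  generalize log (log Y) = l at *
  constructor
  · rw [div_le_iff₀ (by positivity)]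
    exact mul_le_mul_of_nonneg_left (by linarith) hY.le
  · rw [← mul_div_assoc, ← mul_div_assoc, div_le_div_iff₀ hl0 (by positivity)]
    have : (2 - ε) * ((l + m) / 2) ≤ (1 - ε / 4) * l := by nlinarith
    nlinarith [mul_le_mul_of_nonneg_left this hlam]

end Asymptotics

/-- For every `ε > 0` and all sufficiently large `Y`: with `λ = √(log Y log₂ Y)` and `r`
the multiplicative function supported on squarefree integers with
`r(p) = λ/(√p log p)` for primes `λ ≤ p ≤ exp((log λ)²)` and `r(p) = 0` otherwise,
for every `N` with `log N > 3 λ log log λ`,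
`(∑_{a,b ≤ Y} ∑_{m,n ≤ N, an = bm} r(a) r(b)) / ∑_{n ≤ Y} r(n)²
  ≥ N exp((2-ε) √(log Y / log log Y))`. -/
theorem resonator_ratio_lower_bound :
    ∀ ε : ℝ, 0 < ε → ∃ Y₀ : ℝ, ∀ Y : ℝ, Y₀ ≤ Y →
      ∀ r : ℕ → ℝ, r 1 = 1 →
        (∀ m n : ℕ, Nat.Coprime m n → r (m * n) = r m * r n) →
        (∀ n : ℕ, ¬ Squarefree n → r n = 0) →
        (∀ p : ℕ, p.Prime →
          r p = if lam Y ≤ (p : ℝ) ∧ (p : ℝ) ≤ Real.exp ((Real.log (lam Y)) ^ 2)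
            then lam Y / (Real.sqrt p * Real.log p) else 0) →
        ∀ N : ℝ, 3 * lam Y * Real.log (Real.log (lam Y)) < Real.log N →
          N * Real.exp ((2 - ε) * Real.sqrt (Real.log Y / Real.log (Real.log Y))) ≤
            (∑ a ∈ Finset.Icc 1 ⌊Y⌋₊, ∑ b ∈ Finset.Icc 1 ⌊Y⌋₊,
              ∑ m ∈ Finset.Icc 1 ⌊N⌋₊, ∑ n ∈ Finset.Icc 1 ⌊N⌋₊,
                if a * n = b * m then r a * r b else 0) /
              (∑ n ∈ Finset.Icc 1 ⌊Y⌋₊, (r n) ^ 2) := by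
  intro ε hε
  have hε' : 0 < min ε 1 := lt_min hε one_pos
  obtain ⟨Y₀, hY₀⟩ := Filter.eventually_atTop.mp
    ((tendsto_lam_atTop.eventually (eventually_mul_sqSum_le_ratioSum hε' (min_le_right ε 1))).and
      ((eventually_sqrt_log_div_le hε').and (Filter.eventually_gt_atTop 1)))
  refine ⟨Y₀, fun Y hY r h1 hmul hsq hp N hN => ?_⟩
  obtain ⟨hmain, ⟨hlog, hexp⟩, hY1⟩ := hY₀ Y hY
  have hr : IsResonatorWith (lam Y) r := by
    refine ⟨⟨h1, hmul, hsq, fun p hpp => ?_⟩, hp⟩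
    have := Real.log_natCast_nonneg p
    have : 0 ≤ lam Y := Real.sqrt_nonneg _
    rw [hp p hpp]
    split_ifs <;> positivity
  rcases le_or_gt N 0 with hN0 | hN0
  · rw [Nat.floor_of_nonpos hN0]
    simpa using mul_nonpos_of_nonpos_of_nonneg hN0 (Real.exp_pos _).le
  · refine (le_div_iff₀ (hr.sqSum_pos hY1.le)).mpr (le_trans ?_ (hmain r Y N hr hY1 hlog hN0 hN))
    refine mul_le_mul_of_nonneg_right (mul_le_mul_of_nonneg_left (Real.exp_le_exp.mpr ?_) hN0.le)
      (sqSum_nonneg Y)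
    refine le_trans (mul_le_mul_of_nonneg_right ?_ (Real.sqrt_nonneg _)) hexp
    linarith [min_le_left ε 1]
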